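/- arXiv:0711.1937 — 4 statements merged into one kernel-verified Lean document; each statement's English description precedes it below -/
import Mathlib

section
/- Let s ≥ 2, m ≥ 0, and let i,k satisfy 1 ≤ i ≤ s−1 and k ≥ i+1. Then 16 · Γ_i^{[s,s+m]×k} = 21·2^{3i} − 3·2^{2i+1}; in particular Γ_i^{[s,s+m]×k} depends only on i (not on s, m, or k) in this range. -/
open Matrix

/-- The `a × k` Hankel (persymmetric) matrix over `F_2` whose `(i,j)` entry is `α (i+j)`. -/
def hankel (a k : ℕ) (α : Fin (a + k - 1) → ZMod 2) :
    Matrix (Fin a) (Fin k) (ZMod 2) :=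
  Matrix.of fun i j => α ⟨(i : ℕ) + (j : ℕ), by have := i.isLt; have := j.isLt; omega⟩

/-- `Γ_i^{[a,b]×k}` : the number of pairs `(α, β)` such that the `(a+b) × k` matrix obtained
by stacking the `a × k` Hankel matrix of `α` on top of the `b × k` Hankel matrix of `β`
has rank `i` over `F_2`. -/
noncomputable def Gamma (a b k i : ℕ) : ℕ :=
  Nat.card {p : (Fin (a + k - 1) → ZMod 2) × (Fin (b + k - 1) → ZMod 2) //
    (Matrix.fromRows (hankel a k p.1) (hankel b k p.2)).rank = i}

open Polynomial

section General

variable {F : Type*} [Field F]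

/-- Two Hankel matrices with `k` columns, built from infinite sequences, stacked. -/
def stackedHankel (a b k : ℕ) (α β : ℕ → F) : Matrix (Fin a ⊕ Fin b) (Fin k) F :=
  fromRows (of fun i j => α (i + j)) (of fun i j => β (i + j))

/-- The linear functional on polynomials sending `X ^ n` to `α n`. -/
noncomputable def seqPairing (α : ℕ → F) : F[X] →ₗ[F] F :=
  Polynomial.lsum fun n => LinearMap.mulLeft F (α n)

theorem seqPairing_monomial (α : ℕ → F) (n : ℕ) (c : F) :
    seqPairing α (monomial n c) = α n * c := by
  simp [seqPairing, Polynomial.lsum_apply, sum_monomial_index]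

theorem seqPairing_X_mul (α : ℕ → F) (P : F[X]) :
    seqPairing α (X * P) = seqPairing (fun n => α (n + 1)) P := by
  induction P using Polynomial.induction_on' with
  | add p q hp hq => rw [mul_add, map_add, map_add, hp, hq]
  | monomial n c => rw [X_mul_monomial, seqPairing_monomial, seqPairing_monomial]

/-- The polynomial of degree `< k` with the given vector of coefficients. -/
noncomputable def vecPoly (F : Type*) [Field F] (k : ℕ) : (Fin k → F) →ₗ[F] F[X] :=
  (degreeLT F k).subtype ∘ₗ (degreeLTEquiv F k).symm.toLinearMap

theorem vecPoly_apply (k : ℕ) (x : Fin k → F) :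
    vecPoly F k x = ∑ i : Fin k, monomial (i : ℕ) (x i) := rfl

theorem vecPoly_injective (k : ℕ) : Function.Injective (vecPoly F k) :=
  (degreeLT F k).injective_subtype.comp (degreeLTEquiv F k).symm.injective

theorem range_vecPoly (k : ℕ) : LinearMap.range (vecPoly F k) = degreeLT F k := by
  rw [vecPoly, LinearMap.range_comp, LinearEquiv.range, Submodule.map_top,
    Submodule.range_subtype]

theorem seqPairing_vecPoly (α : ℕ → F) (k : ℕ) (x : Fin k → F) :
    seqPairing α (vecPoly F k x) = ∑ j : Fin k, α j * x j := by
  rw [vecPoly_apply, map_sum]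
  exact Finset.sum_congr rfl fun _ _ => seqPairing_monomial _ _ _

/-- The kernel of a stacked Hankel matrix, as a space of polynomials. -/
noncomputable def rightKer (a b k : ℕ) (α β : ℕ → F) : Submodule F F[X] :=
  (LinearMap.ker (stackedHankel a b k α β).mulVecLin).map (vecPoly F k)

theorem mem_rightKer {a b k : ℕ} {α β : ℕ → F} {P : F[X]} :
    P ∈ rightKer a b k α β ↔ P ∈ degreeLT F k ∧
      (∀ i < a, seqPairing (fun n => α (i + n)) P = 0) ∧
      ∀ i < b, seqPairing (fun n => β (i + n)) P = 0 := by
  have key (x : Fin k → F) : x ∈ LinearMap.ker (stackedHankel a b k α β).mulVecLin ↔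
      (∀ i < a, seqPairing (fun n => α (i + n)) (vecPoly F k x) = 0) ∧
      ∀ i < b, seqPairing (fun n => β (i + n)) (vecPoly F k x) = 0 := by
    simp only [LinearMap.mem_ker, mulVecLin_apply, stackedHankel, fromRows_mulVec,
      seqPairing_vecPoly, funext_iff, Sum.forall, Sum.elim_inl, Sum.elim_inr, mulVec,
      dotProduct, of_apply, Pi.zero_apply, Fin.forall_iff]
  rw [← range_vecPoly]
  constructor
  · rintro ⟨x, hx, rfl⟩
    exact ⟨⟨x, rfl⟩, (key x).1 hx⟩
  · rintro ⟨⟨x, rfl⟩, h⟩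
    exact ⟨x, (key x).2 h, rfl⟩

theorem finrank_rightKer_add_rank (a b k : ℕ) (α β : ℕ → F) :
    Module.finrank F (rightKer a b k α β) + (stackedHankel a b k α β).rank = k := by
  rw [rightKer, ← (Submodule.equivMapOfInjective _ (vecPoly_injective k) _).finrank_eq,
    add_comm, Matrix.rank, LinearMap.finrank_range_add_finrank_ker, Module.finrank_fin_fun]

/-- The pair of polynomials encoded by a vector indexed by a disjoint union. -/
noncomputable def vecPolyPair (F : Type*) [Field F] (a b : ℕ) :
    (Fin a ⊕ Fin b → F) →ₗ[F] F[X] × F[X] :=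
  ((vecPoly F a).prodMap (vecPoly F b)) ∘ₗ
    (LinearEquiv.sumArrowLequivProdArrow (Fin a) (Fin b) F F).toLinearMap

theorem vecPolyPair_apply (a b : ℕ) (x : Fin a ⊕ Fin b → F) :
    vecPolyPair F a b x =
      (vecPoly F a fun i => x (Sum.inl i), vecPoly F b fun i => x (Sum.inr i)) := rfl

theorem vecPolyPair_injective (a b : ℕ) : Function.Injective (vecPolyPair F a b) :=
  ((vecPoly_injective a).prodMap (vecPoly_injective b)).comp
    (LinearEquiv.sumArrowLequivProdArrow (Fin a) (Fin b) F F).injective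

/-- The left kernel of a stacked Hankel matrix, as a space of pairs of polynomials. -/
noncomputable def leftKer (a b k : ℕ) (α β : ℕ → F) : Submodule F (F[X] × F[X]) :=
  (LinearMap.ker (stackedHankel a b k α β)ᵀ.mulVecLin).map (vecPolyPair F a b)

theorem mem_leftKer {a b k : ℕ} {α β : ℕ → F} {P : F[X] × F[X]} :
    P ∈ leftKer a b k α β ↔ P.1 ∈ degreeLT F a ∧ P.2 ∈ degreeLT F b ∧
      ∀ j < k, seqPairing (fun n => α (n + j)) P.1 + seqPairing (fun n => β (n + j)) P.2 = 0 := by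
  have key (x : Fin a ⊕ Fin b → F) :
      x ∈ LinearMap.ker (stackedHankel a b k α β)ᵀ.mulVecLin ↔
      ∀ j < k, seqPairing (fun n => α (n + j)) (vecPolyPair F a b x).1 +
        seqPairing (fun n => β (n + j)) (vecPolyPair F a b x).2 = 0 := by
    simp only [LinearMap.mem_ker, mulVecLin_apply, stackedHankel, vecPolyPair_apply,
      seqPairing_vecPoly, funext_iff, mulVec, dotProduct, of_apply, Pi.zero_apply,
      Fin.forall_iff, Fintype.sum_sum_type, transpose_apply, fromRows_apply_inl,
      fromRows_apply_inr]
  constructor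
  · rintro ⟨x, hx, rfl⟩
    refine ⟨?_, ?_, (key x).1 hx⟩
    · rw [← range_vecPoly]; exact ⟨_, rfl⟩
    · rw [← range_vecPoly]; exact ⟨_, rfl⟩
  · obtain ⟨P, Q⟩ := P
    rintro ⟨hP, hQ, h⟩
    rw [← range_vecPoly] at hP hQ
    obtain ⟨x, rfl⟩ := hP
    obtain ⟨y, rfl⟩ := hQ
    exact ⟨Sum.elim x y, (key _).2 h, rfl⟩

theorem finrank_leftKer_add_rank (a b k : ℕ) (α β : ℕ → F) :
    Module.finrank F (leftKer a b k α β) + (stackedHankel a b k α β).rank = a + b := by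
  rw [leftKer, ← (Submodule.equivMapOfInjective _ (vecPolyPair_injective a b) _).finrank_eq,
    add_comm, ← Matrix.rank_transpose, Matrix.rank, LinearMap.finrank_range_add_finrank_ker,
    Module.finrank_fintype_fun_eq_card, Fintype.card_sum, Fintype.card_fin, Fintype.card_fin]

theorem X_mul_mem_degreeLT {k : ℕ} {P : F[X]} (hP : P ∈ degreeLT F k) :
    X * P ∈ degreeLT F (k + 1) := by
  rw [mem_degreeLT] at *
  by_cases h : P = 0
  · simp [h]
  · rw [degree_eq_natDegree h] at hP
    rw [degree_mul, degree_X, degree_eq_natDegree h]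
    norm_cast at *
    omega

/-- A nonzero space of polynomials of bounded degree is not stable under multiplication by `X`. -/
theorem exists_X_mul_notMem {k : ℕ} {L : Submodule F F[X]} (hL : L ≤ degreeLT F k)
    (h0 : L ≠ ⊥) : ∃ P ∈ L, X * P ∉ L := by
  by_contra! h
  obtain ⟨P, hP, hP0⟩ := L.exists_mem_ne_zero_of_ne_bot h0
  have hpow (n : ℕ) : X ^ n * P ∈ L := by
    induction n with
    | zero => simpa
    | succ n ih => rw [pow_succ', mul_assoc]; exact h _ ih
  have := mem_degreeLT.1 (hL (hpow k))
  rw [degree_mul, degree_X_pow, degree_eq_natDegree hP0] at this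
  norm_cast at this
  omega

instance finiteDimensional_rightKer (a b k : ℕ) (α β : ℕ → F) :
    FiniteDimensional F (rightKer a b k α β) := by
  unfold rightKer; infer_instance

instance finiteDimensional_leftKer (a b k : ℕ) (α β : ℕ → F) :
    FiniteDimensional F (leftKer a b k α β) := by
  unfold leftKer; infer_instance

theorem rank_stackedHankel_add_column_le {a b k : ℕ} {α β : ℕ → F}
    (h : (stackedHankel (a + 1) (b + 1) k α β).rank < k) :
    (stackedHankel a b (k + 1) α β).rank ≤ (stackedHankel (a + 1) (b + 1) k α β).rank := by
  have h1 := finrank_rightKer_add_rank (a + 1) (b + 1) k α β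
  have h2 := finrank_rightKer_add_rank a b (k + 1) α β
  have hne : rightKer (a + 1) (b + 1) k α β ≠ ⊥ := by
    intro h0
    rw [h0, finrank_bot] at h1
    omega
  obtain ⟨P, hP, hXP⟩ := exists_X_mul_notMem (fun P hP => (mem_rightKer.1 hP).1) hne
  have hle : rightKer (a + 1) (b + 1) k α β ≤ rightKer a b (k + 1) α β := by
    intro Q hQ
    rw [mem_rightKer] at *
    exact ⟨degreeLT_mono k.le_succ hQ.1, fun i hi => hQ.2.1 i (by omega),
      fun i hi => hQ.2.2 i (by omega)⟩
  have hmem : X * P ∈ rightKer a b (k + 1) α β := by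
    rw [mem_rightKer] at *
    refine ⟨X_mul_mem_degreeLT hP.1, fun i hi => ?_, fun i hi => ?_⟩
    · rw [seqPairing_X_mul, ← hP.2.1 (i + 1) (by omega)]
      simp only [add_assoc, add_comm 1]
    · rw [seqPairing_X_mul, ← hP.2.2 (i + 1) (by omega)]
      simp only [add_assoc, add_comm 1]
  have := Submodule.finrank_lt_finrank_of_lt
    (lt_of_le_of_ne hle fun he => hXP (he ▸ hmem))
  omega

theorem rank_stackedHankel_add_rows_le {a b k : ℕ} {α β : ℕ → F}
    (ha : (stackedHankel a b (k + 1) α β).rank < a)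
    (hb : (stackedHankel a b (k + 1) α β).rank < b) :
    (stackedHankel (a + 1) (b + 1) k α β).rank ≤ (stackedHankel a b (k + 1) α β).rank := by
  have h1 := finrank_leftKer_add_rank (a + 1) (b + 1) k α β
  have h2 := finrank_leftKer_add_rank a b (k + 1) α β
  set L := leftKer a b (k + 1) α β with hL
  have hL1 : ∀ P ∈ L, P.1 ∈ degreeLT F a := fun P hP => (mem_leftKer.1 hP).1
  have hL2 : ∀ P ∈ L, P.2 ∈ degreeLT F b := fun P hP => (mem_leftKer.1 hP).2.1
  have hfin (n : ℕ) : Module.finrank F (degreeLT F n) = n := by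
    rw [(degreeLTEquiv F n).finrank_eq, Module.finrank_fin_fun]
  have hfd (n : ℕ) : FiniteDimensional F (degreeLT F n) :=
    (degreeLTEquiv F n).symm.finiteDimensional
  have hU : L.comap (LinearMap.inl F F[X] F[X]) ≠ ⊥ := by
    intro h0
    have hinj : Function.Injective
        (((LinearMap.snd F F[X] F[X]).restrict (p := L) (q := degreeLT F b) hL2)) := by
      rw [injective_iff_map_eq_zero]
      rintro ⟨⟨p, q⟩, hpq⟩ hz
      have hq : q = 0 := congrArg Subtype.val hz
      subst hq
      have hp : p ∈ L.comap (LinearMap.inl F F[X] F[X]) := hpq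
      rw [h0, Submodule.mem_bot] at hp
      subst hp
      rfl
    have := LinearMap.finrank_le_finrank_of_injective hinj
    rw [hfin] at this
    omega
  have hV : L.map (LinearMap.snd F F[X] F[X]) ≠ ⊥ := by
    intro h0
    have hinj : Function.Injective
        (((LinearMap.fst F F[X] F[X]).restrict (p := L) (q := degreeLT F a) hL1)) := by
      rw [injective_iff_map_eq_zero]
      rintro ⟨⟨p, q⟩, hpq⟩ hz
      have hp : p = 0 := congrArg Subtype.val hz
      subst hp
      have hq : q ∈ L.map (LinearMap.snd F F[X] F[X]) := ⟨_, hpq, rfl⟩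
      rw [h0, Submodule.mem_bot] at hq
      subst hq
      rfl
    have := LinearMap.finrank_le_finrank_of_injective hinj
    rw [hfin] at this
    omega
  obtain ⟨u, hu, hXu⟩ := exists_X_mul_notMem (k := a) (fun p hp => hL1 _ hp) hU
  obtain ⟨_, ⟨⟨p, q⟩, hpq, rfl⟩, hXq⟩ := exists_X_mul_notMem (k := b)
    (by rintro _ ⟨P, hP, rfl⟩; exact hL2 _ hP) hV
  have hle : L ≤ leftKer (a + 1) (b + 1) k α β := by
    intro Q hQ
    rw [hL, mem_leftKer] at hQ
    rw [mem_leftKer]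
    exact ⟨degreeLT_mono a.le_succ hQ.1, degreeLT_mono b.le_succ hQ.2.1,
      fun j hj => hQ.2.2 j (by omega)⟩
  have hmem (P : F[X] × F[X]) (hP : P ∈ L) :
      (X * P.1, X * P.2) ∈ leftKer (a + 1) (b + 1) k α β := by
    rw [hL, mem_leftKer] at hP
    rw [mem_leftKer]
    refine ⟨X_mul_mem_degreeLT hP.1, X_mul_mem_degreeLT hP.2.1, fun j hj => ?_⟩
    rw [seqPairing_X_mul, seqPairing_X_mul, ← hP.2.2 (j + 1) (by omega)]
    simp only [add_assoc, add_comm 1]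
  have hu' : ((X * u, 0) : F[X] × F[X]) ∈ leftKer (a + 1) (b + 1) k α β := by
    simpa using hmem (u, 0) hu
  set L₁ := L ⊔ Submodule.span F {((X * u, 0) : F[X] × F[X])} with hL₁
  have hlt1 : L < L₁ := by
    refine lt_of_le_of_ne le_sup_left fun he => hXu ?_
    have : ((X * u, 0) : F[X] × F[X]) ∈ L₁ :=
      Submodule.mem_sup_right (Submodule.mem_span_singleton_self _)
    rwa [← he] at this
  have hle1 : L₁ ≤ leftKer (a + 1) (b + 1) k α β :=
    sup_le hle ((Submodule.span_singleton_le_iff_mem _ _).2 hu')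
  have hmap : L₁.map (LinearMap.snd F F[X] F[X]) = L.map (LinearMap.snd F F[X] F[X]) := by
    rw [hL₁, Submodule.map_sup, Submodule.map_span, Set.image_singleton]
    simp
  have hlt2 : L₁ < leftKer (a + 1) (b + 1) k α β := by
    refine lt_of_le_of_ne hle1 fun he => hXq ?_
    have := hmem _ hpq
    rw [← he] at this
    rw [← hmap]
    exact ⟨_, this, rfl⟩
  have : FiniteDimensional F L₁ := Submodule.finiteDimensional_of_le hle1
  have h3 := Submodule.finrank_lt_finrank_of_lt hlt1
  have h4 := Submodule.finrank_lt_finrank_of_lt hlt2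
  omega

theorem rank_stackedHankel_eq_iff {a b k i : ℕ} {α β : ℕ → F} (ha : i < a) (hb : i < b)
    (hk : i < k) :
    (stackedHankel (a + 1) (b + 1) k α β).rank = i ↔ (stackedHankel a b (k + 1) α β).rank = i := by
  constructor
  · intro h
    have h1 := rank_stackedHankel_add_column_le (a := a) (b := b) (k := k) (α := α) (β := β)
      (by omega)
    have h2 := rank_stackedHankel_add_rows_le (a := a) (b := b) (k := k) (α := α) (β := β)
      (by omega) (by omega)
    omega
  · intro h
    have h2 := rank_stackedHankel_add_rows_le (a := a) (b := b) (k := k) (α := α) (β := β)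
      (by omega) (by omega)
    have h1 := rank_stackedHankel_add_column_le (a := a) (b := b) (k := k) (α := α) (β := β)
      (by omega)
    omega

/-- Extension of a finite sequence by zero. -/
def zeroExtend {N : ℕ} (α : Fin N → F) (n : ℕ) : F :=
  if h : n < N then α ⟨n, h⟩ else 0

/-- For fixed `h`, the map sending a sequence to the product of its Hankel matrix with `h`. -/
def hankelMulVec (N d : ℕ) (h : Fin (d + 1) → F) : (Fin N → F) →ₗ[F] (Fin (N - d) → F) where
  toFun α := fun i => ∑ j : Fin (d + 1), zeroExtend α (i + j) * h j
  map_add' α β := by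
    ext i
    simp only [Pi.add_apply, ← Finset.sum_add_distrib, ← add_mul]
    refine Finset.sum_congr rfl fun j _ => ?_
    unfold zeroExtend
    split_ifs <;> simp
  map_smul' c α := by
    ext i
    simp only [Pi.smul_apply, smul_eq_mul, Finset.mul_sum, ← mul_assoc, RingHom.id_apply]
    refine Finset.sum_congr rfl fun j _ => ?_
    unfold zeroExtend
    split_ifs <;> simp

theorem hankelMulVec_surjective {N d : ℕ} {h : Fin (d + 1) → F} (hh : h ≠ 0) :
    Function.Surjective (hankelMulVec N d h) := by
  rw [← LinearMap.range_eq_top]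
  by_contra hne
  obtain ⟨f, hf0, hf⟩ := Submodule.exists_le_ker_of_lt_top _ (lt_top_iff_ne_top.2 hne)
  set c : Fin (N - d) → F := fun i => f (Pi.single i 1) with hc
  have hfc (y : Fin (N - d) → F) : f y = ∑ i, c i * y i := by
    conv_lhs => rw [pi_eq_sum_univ' y]
    simp [hc, mul_comm]
  have hc0 : c ≠ 0 := by
    intro h0
    refine hf0 (LinearMap.ext fun y => ?_)
    simp [hfc, h0]
  have hprod : vecPoly F _ c * vecPoly F _ h ≠ 0 :=
    mul_ne_zero ((map_ne_zero_iff _ (vecPoly_injective _)).2 hc0)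
      ((map_ne_zero_iff _ (vecPoly_injective _)).2 hh)
  refine hprod (Polynomial.ext fun n => ?_)
  have hcoeff : (vecPoly F _ c * vecPoly F _ h).coeff n =
      ∑ i : Fin (N - d), c i * ∑ j : Fin (d + 1), (if (i : ℕ) + j = n then 1 else 0) * h j := by
    rw [vecPoly_apply, vecPoly_apply, Finset.sum_mul_sum]
    simp only [monomial_mul_monomial, finsetSum_coeff, coeff_monomial, Finset.mul_sum, ite_mul,
      one_mul, zero_mul, mul_ite, mul_zero]
  rw [hcoeff, coeff_zero]
  have hz : f (hankelMulVec N d h fun l => if (l : ℕ) = n then 1 else 0) = 0 :=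
    hf ⟨_, rfl⟩
  rw [hfc] at hz
  refine Eq.trans ?_ hz
  refine Finset.sum_congr rfl fun i _ => ?_
  congr 1
  refine Finset.sum_congr rfl fun j _ => ?_
  have : (i : ℕ) + j < N := by omega
  simp [zeroExtend, this]

end General

theorem card_ker_hankelMulVec {N d : ℕ} (hd : d ≤ N) {h : Fin (d + 1) → ZMod 2} (hh : h ≠ 0) :
    Nat.card {α : Fin N → ZMod 2 // hankelMulVec N d h α = 0} = 2 ^ d := by
  have h1 := LinearMap.finrank_range_add_finrank_ker (hankelMulVec N d h)
  rw [LinearMap.range_eq_top.2 (hankelMulVec_surjective hh), finrank_top,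
    Module.finrank_fin_fun, Module.finrank_fin_fun] at h1
  have h2 := Module.natCard_eq_pow_finrank (K := ZMod 2)
    (V := LinearMap.ker (hankelMulVec N d h))
  rw [Nat.card_zmod, show Module.finrank (ZMod 2) (LinearMap.ker (hankelMulVec N d h)) = d by
    omega] at h2
  exact h2

/-- The stacked Hankel matrix with `d + 1` columns using all terms of two finite sequences. -/
def fullHankel {M N : ℕ} (d : ℕ) (p : (Fin M → ZMod 2) × (Fin N → ZMod 2)) :
    Matrix (Fin (M - d) ⊕ Fin (N - d)) (Fin (d + 1)) (ZMod 2) :=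
  stackedHankel (M - d) (N - d) (d + 1) (zeroExtend p.1) (zeroExtend p.2)

/-- The number of pairs of sequences whose stacked Hankel matrix has rank `i`. -/
noncomputable def rankCount (M N d i : ℕ) : ℕ :=
  Fintype.card {p : (Fin M → ZMod 2) × (Fin N → ZMod 2) // (fullHankel d p).rank = i}

theorem rankCount_succ {M N d i : ℕ} (hi : i ≤ d) (hM : i + d + 1 < M) (hN : i + d + 1 < N) :
    rankCount M N (d + 1) i = rankCount M N d i := by
  refine Fintype.card_congr (Equiv.subtypeEquivRight fun p => ?_)
  have h := rank_stackedHankel_eq_iff (a := M - (d + 1)) (b := N - (d + 1)) (k := d + 1) (i := i)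
    (α := zeroExtend p.1) (β := zeroExtend p.2) (by omega) (by omega) (by omega)
  rw [show M - (d + 1) + 1 = M - d by omega, show N - (d + 1) + 1 = N - d by omega] at h
  exact h.symm

theorem rankCount_eq {M N d i : ℕ} (hi : i ≤ d) (hM : i + d < M) (hN : i + d < N) :
    rankCount M N d i = rankCount M N i i := by
  induction d, hi using Nat.le_induction with
  | base => rfl
  | succ d hd ih => rw [rankCount_succ hd (by omega) (by omega), ih (by omega) (by omega)]

theorem sum_rankCount_mul {M N d : ℕ} (w : ℕ → ℕ) :
    ∑ j ∈ Finset.range (d + 2), rankCount M N d j * w j =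
      ∑ p : (Fin M → ZMod 2) × (Fin N → ZMod 2), w (fullHankel d p).rank := by
  have hmaps : ∀ p ∈ (Finset.univ : Finset ((Fin M → ZMod 2) × (Fin N → ZMod 2))),
      (fullHankel d p).rank ∈ Finset.range (d + 2) := fun p _ => by
    have := Matrix.rank_le_card_width (fullHankel d p)
    rw [Fintype.card_fin] at this
    simp only [Finset.mem_range]
    omega
  rw [← Finset.sum_fiberwise_of_maps_to hmaps]
  refine Finset.sum_congr rfl fun j _ => ?_
  rw [rankCount, Fintype.card_subtype, ← smul_eq_mul, ← Finset.sum_const]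
  exact Finset.sum_congr rfl fun p hp => by rw [(Finset.mem_filter.1 hp).2]

theorem fullHankel_mulVec_eq_zero_iff {M N d : ℕ} (p : (Fin M → ZMod 2) × (Fin N → ZMod 2))
    (h : Fin (d + 1) → ZMod 2) :
    fullHankel d p *ᵥ h = 0 ↔ hankelMulVec M d h p.1 = 0 ∧ hankelMulVec N d h p.2 = 0 := by
  simp only [fullHankel, stackedHankel, fromRows_mulVec, hankelMulVec, funext_iff, Sum.forall,
    Sum.elim_inl, Sum.elim_inr, mulVec, dotProduct, of_apply, Pi.zero_apply, LinearMap.coe_mk,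
    AddHom.coe_mk]

theorem sum_rankCount_mul_two_pow {M N d : ℕ} (hM : d ≤ M) (hN : d ≤ N) :
    ∑ j ∈ Finset.range (d + 2), rankCount M N d j * 2 ^ (d + 1 - j) =
      2 ^ (M + N) + (2 ^ (d + 1) - 1) * 4 ^ d := by
  rw [sum_rankCount_mul fun j => 2 ^ (d + 1 - j)]
  have hker (p : (Fin M → ZMod 2) × (Fin N → ZMod 2)) : 2 ^ (d + 1 - (fullHankel d p).rank) =
      ∑ h : Fin (d + 1) → ZMod 2, if fullHankel d p *ᵥ h = 0 then 1 else 0 := by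
    have h1 := LinearMap.finrank_range_add_finrank_ker (fullHankel d p).mulVecLin
    rw [Module.finrank_fin_fun] at h1
    have h2 := Module.natCard_eq_pow_finrank (K := ZMod 2)
      (V := LinearMap.ker (fullHankel d p).mulVecLin)
    rw [Nat.card_zmod, Nat.eq_sub_of_add_eq' h1] at h2
    rw [Matrix.rank, ← h2, Finset.sum_boole, Nat.cast_id, ← Fintype.card_subtype,
      ← Nat.card_eq_fintype_card]
    rfl
  simp only [hker]
  rw [Finset.sum_comm, ← Finset.add_sum_erase _ _ (Finset.mem_univ 0)]
  congr 1
  · simp [pow_add]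
  · have hconst : ∀ h ∈ Finset.univ.erase (0 : Fin (d + 1) → ZMod 2),
        (∑ p : (Fin M → ZMod 2) × (Fin N → ZMod 2),
          if fullHankel d p *ᵥ h = 0 then 1 else 0) = 4 ^ d := by
      intro h hh
      have hh := Finset.ne_of_mem_erase hh
      simp only [fullHankel_mulVec_eq_zero_iff]
      rw [Finset.sum_boole, Nat.cast_id, ← Fintype.card_subtype, ← Nat.card_eq_fintype_card,
        Nat.card_congr (Equiv.subtypeProdEquivProd (p := fun α => hankelMulVec M d h α = 0)
          (q := fun β => hankelMulVec N d h β = 0)),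
        Nat.card_prod, card_ker_hankelMulVec hM hh, card_ker_hankelMulVec hN hh, ← mul_pow]
      norm_num
    rw [Finset.sum_congr rfl hconst, Finset.sum_const, smul_eq_mul,
      Finset.card_erase_of_mem (Finset.mem_univ _)]
    simp

theorem sum_rankCount_mul_two_pow_sub_one {M N d : ℕ} (hM : 2 * d < M) (hN : 2 * d < N) :
    ∑ j ∈ Finset.range (d + 1), (rankCount M N j j : ℤ) * (2 ^ (d + 1 - j) - 1) =
      (2 ^ (d + 1) - 1) * 4 ^ d := by
  have h1 := sum_rankCount_mul_two_pow (M := M) (N := N) (d := d) (by omega) (by omega)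
  have h2 := sum_rankCount_mul (M := M) (N := N) (d := d) fun _ => 1
  have hcard : ∑ _p : (Fin M → ZMod 2) × (Fin N → ZMod 2), 1 = 2 ^ (M + N) := by
    simp [pow_add]
  rw [hcard] at h2
  have hpos : 1 ≤ 2 ^ (d + 1) := Nat.one_le_two_pow
  zify [hpos] at h1 h2
  have h3 : ∑ j ∈ Finset.range (d + 2), (rankCount M N d j : ℤ) * (2 ^ (d + 1 - j) - 1) =
      (2 ^ (d + 1) - 1) * 4 ^ d := by
    simp only [mul_sub, Finset.sum_sub_distrib]
    linarith
  rw [Finset.sum_range_succ, Nat.sub_self, pow_zero, sub_self, mul_zero, add_zero] at h3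
  rw [← h3]
  refine Finset.sum_congr rfl fun j hj => ?_
  have := Finset.mem_range.1 hj
  rw [rankCount_eq (d := d) (i := j) (by omega) (by omega) (by omega)]

theorem sixteen_mul_rankCount {M N i : ℕ} (hi : 1 ≤ i) (hM : 2 * i < M) (hN : 2 * i < N) :
    16 * (rankCount M N i i : ℤ) = 21 * 2 ^ (3 * i) - 3 * 2 ^ (2 * i + 1) := by
  have key (d : ℕ) (hd : d ≤ i) :=
    sum_rankCount_mul_two_pow_sub_one (M := M) (N := N) (d := d) (by omega) (by omega)
  obtain rfl | ⟨n, rfl⟩ : i = 1 ∨ ∃ n, i = n + 2 := by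
    rcases i with _ | _ | n
    · omega
    · exact Or.inl rfl
    · exact Or.inr ⟨n, rfl⟩
  · have h0 := key 0 (by omega)
    have h1 := key 1 le_rfl
    norm_num [Finset.sum_range_succ] at h0 h1 ⊢
    linarith
  · have h0 := key n (by omega)
    have h1 := key (n + 1) (by omega)
    have h2 := key (n + 2) le_rfl
    have hrec : ∑ j ∈ Finset.range (n + 1), (rankCount M N j j : ℤ) * (2 ^ (n + 2 + 1 - j) - 1) =
        3 * ∑ j ∈ Finset.range (n + 1), (rankCount M N j j : ℤ) * (2 ^ (n + 1 + 1 - j) - 1) -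
        2 * ∑ j ∈ Finset.range (n + 1), (rankCount M N j j : ℤ) * (2 ^ (n + 1 - j) - 1) := by
      rw [Finset.mul_sum, Finset.mul_sum, ← Finset.sum_sub_distrib]
      refine Finset.sum_congr rfl fun j hj => ?_
      have := Finset.mem_range.1 hj
      rw [show n + 2 + 1 - j = n + 1 - j + 2 by omega, show n + 1 + 1 - j = n + 1 - j + 1 by omega]
      ring
    rw [Finset.sum_range_succ] at h1
    rw [Finset.sum_range_succ, Finset.sum_range_succ, hrec] at h2
    rw [show n + 1 + 1 - (n + 1) = 1 by omega] at h1
    rw [show n + 2 + 1 - (n + 1) = 2 by omega, show n + 2 + 1 - (n + 1 + 1) = 1 by omega] at h2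
    have e8 : (2 : ℤ) ^ (3 * (n + 2)) = 64 * (2 ^ n * 4 ^ n) := by
      rw [pow_mul, ← mul_pow]; norm_num [pow_add]; ring
    have e4 : (2 : ℤ) ^ (2 * (n + 2) + 1) = 32 * 4 ^ n := by
      rw [pow_succ, pow_mul]; norm_num [pow_add]; ring
    rw [e8, e4]
    ring_nf at h0 h1 h2 ⊢
    linarith

theorem Gamma_eq_rankCount (a b d i : ℕ) :
    Gamma a b (d + 1) i = rankCount (a + d) (b + d) d i := by
  rw [Gamma, rankCount, Nat.card_eq_fintype_card]
  refine Fintype.card_congr (Equiv.subtypeEquivRight fun p => ?_)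
  have h : fromRows (hankel a (d + 1) p.1) (hankel b (d + 1) p.2) =
      stackedHankel a b (d + 1) (zeroExtend p.1) (zeroExtend p.2) := by
    unfold hankel stackedHankel
    congr 1 <;> ext i j <;>
      simp only [of_apply, zeroExtend] <;> rw [dif_pos]
  rw [h, fullHankel, Nat.add_sub_cancel, Nat.add_sub_cancel]

theorem Gamma_low_rank (s m k i : ℕ) (hs : 2 ≤ s) (hi1 : 1 ≤ i) (hi2 : i ≤ s - 1)
    (hk : i + 1 ≤ k) :
    (16 : ℤ) * Gamma s (s + m) k i = 21 * 2 ^ (3 * i) - 3 * 2 ^ (2 * i + 1) := by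
  obtain ⟨d, rfl⟩ : ∃ d, k = d + 1 := ⟨k - 1, by omega⟩
  rw [Gamma_eq_rankCount, rankCount_eq (by omega) (by omega) (by omega)]
  exact sixteen_mul_rankCount hi1 (by omega) (by omega)
end

section
/- Let s ≥ 2, m ≥ 0 and 1 ≤ k ≤ s. Then 8 · Γ_k^{[s,s+m]×k} = 2^{2k+2s+m+1} − 3·2^{3k−1} + 2^{2k}; i.e. the number of full-column-rank double persymmetric (2s+m)×k matrices is 2^{2k+2s+m−2} − 3·2^{3k−4} + 2^{2k−3}. -/
open Matrix

open Polynomial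

/-- The polynomials `f` such that `φ` kills `f, X f, …, X ^ (a - 1) f`. -/
noncomputable def shiftAnnihilator {F : Type*} [Field F] (φ : F[X] →ₗ[F] F) (a : ℕ) : Submodule F F[X] where
  carrier := {f | ∀ i < a, φ (X ^ i * f) = 0}
  add_mem' {f g} hf hg i hi := by rw [mul_add, map_add, hf i hi, hg i hi, add_zero]
  zero_mem' i _ := by simp
  smul_mem' c f hf i hi := by rw [mul_smul_comm, map_smul, hf i hi, smul_zero]

section ShiftAnnihilator

variable {F : Type*} [Field F] {φ ψ : F[X] →ₗ[F] F} {a b n : ℕ}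

theorem mem_shiftAnnihilator {f : F[X]} :
    f ∈ shiftAnnihilator φ a ↔ ∀ i < a, φ (X ^ i * f) = 0 := Iff.rfl

theorem apply_mul_eq_zero_of_mem_shiftAnnihilator {f h : F[X]} (hf : f ∈ shiftAnnihilator φ a)
    (hh : h.degree < a) : φ (h * f) = 0 := by
  have hsum := Polynomial.as_sum_range_C_mul_X_pow h
  rw [hsum, Finset.sum_mul, map_sum]
  refine Finset.sum_eq_zero fun i hi => ?_
  by_cases h0 : h = 0
  · simp [h0]
  have hia : i < a := by
    have := (Polynomial.natDegree_lt_iff_degree_lt h0).2 hh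
    have := Finset.mem_range.1 hi
    omega
  rw [mul_assoc, ← smul_eq_C_mul, map_smul, hf i hia, smul_zero]

theorem mem_shiftAnnihilator_succ (ha : 0 < a) {f : F[X]} :
    f ∈ shiftAnnihilator φ (a + 1) ↔ f ∈ shiftAnnihilator φ a ∧ X * f ∈ shiftAnnihilator φ a := by
  simp only [mem_shiftAnnihilator]
  constructor
  · refine fun h => ⟨fun i hi => h i (by omega), fun i hi => ?_⟩
    rw [← mul_assoc, ← pow_succ]
    exact h (i + 1) (by omega)
  · rintro ⟨h0, h1⟩ i hi
    rcases i with _ | i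
    · exact h0 0 ha
    · rw [pow_succ, mul_assoc]
      exact h1 i (by omega)

theorem mem_shiftAnnihilator_of_isCoprime {g A B : F[X]} (hA : g * A ∈ shiftAnnihilator φ a)
    (hB : g * B ∈ shiftAnnihilator φ a) (hAB : IsCoprime A B) (hB0 : B ≠ 0)
    (hAa : A.natDegree < a) (hBa : B.natDegree < a) : g ∈ shiftAnnihilator φ a := by
  intro i hi
  obtain ⟨u, v, huv⟩ := hAB
  set u' := (X ^ i * u) % B with hu'
  set v' := X ^ i * v + (X ^ i * u) / B * A with hv'
  have key : u' * A + v' * B = X ^ i := by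
    have h1 := EuclideanDomain.mod_add_div (X ^ i * u) B
    linear_combination X ^ i * huv + A * h1
  have hu'deg : u'.degree < B.degree := EuclideanDomain.mod_lt _ hB0
  have hu'a : u'.degree < a :=
    hu'deg.trans ((natDegree_lt_iff_degree_lt hB0).1 hBa)
  have hv'a : v'.degree < a := by
    by_cases hv0 : v' = 0
    · rw [hv0, degree_zero]; exact WithBot.bot_lt_coe a
    rw [← natDegree_lt_iff_degree_lt hv0]
    have h2 : v' * B = X ^ i - u' * A := by linear_combination key
    have h3 : (v' * B).natDegree ≤ max (X ^ i : F[X]).natDegree (u' * A).natDegree := by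
      rw [h2]; exact natDegree_sub_le _ _
    rw [natDegree_mul hv0 hB0, natDegree_X_pow] at h3
    by_cases hu0 : u' = 0
    · simp only [hu0, zero_mul, natDegree_zero] at h3
      omega
    · have h4 : u'.natDegree < B.natDegree := natDegree_lt_natDegree hu0 hu'deg
      have h5 : (u' * A).natDegree ≤ u'.natDegree + A.natDegree := natDegree_mul_le
      omega
  have h6 : X ^ i * g = u' * (g * A) + v' * (g * B) := by linear_combination (-g) * key
  rw [h6, map_add, apply_mul_eq_zero_of_mem_shiftAnnihilator hA hu'a,
    apply_mul_eq_zero_of_mem_shiftAnnihilator hB hv'a, add_zero]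

theorem mul_mem_shiftAnnihilator {g A h : F[X]} (hg : g ∈ shiftAnnihilator φ a)
    (hA : g * A ∈ shiftAnnihilator φ a) (hA0 : A ≠ 0) (hAa : A.natDegree ≤ a)
    (hh : h.natDegree ≤ A.natDegree) : g * h ∈ shiftAnnihilator φ a := by
  intro i hi
  have key := EuclideanDomain.mod_add_div (X ^ i * h) A
  set r := (X ^ i * h) % A
  set q := (X ^ i * h) / A
  have hr : r.degree < A.degree := EuclideanDomain.mod_lt _ hA0
  have hra : r.degree < a :=
    hr.trans_le (degree_le_natDegree.trans (by exact_mod_cast hAa))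
  have hqa : q.degree < a := by
    by_cases hq0 : q = 0
    · rw [hq0, degree_zero]; exact WithBot.bot_lt_coe a
    rw [← natDegree_lt_iff_degree_lt hq0]
    have h1 : (A * q).natDegree ≤ max (X ^ i * h).natDegree r.natDegree := by
      rw [eq_sub_iff_add_eq'.2 key]; exact natDegree_sub_le _ _
    have h3 : r.natDegree ≤ A.natDegree := natDegree_le_natDegree hr.le
    rw [natDegree_mul hA0 hq0] at h1
    have h2 : (X ^ i * h).natDegree ≤ (X ^ i : F[X]).natDegree + h.natDegree := natDegree_mul_le
    rw [natDegree_X_pow] at h2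
    omega
  have h6 : X ^ i * (g * h) = r * g + q * (g * A) := by linear_combination (-g) * key
  rw [h6, map_add, apply_mul_eq_zero_of_mem_shiftAnnihilator hg hra,
    apply_mul_eq_zero_of_mem_shiftAnnihilator hA hqa, add_zero]

/-- The polynomials of degree less than `n` annihilated by the first `a` shifts of `φ` and the
first `b` shifts of `ψ`. -/
noncomputable def jointAnnihilator (φ ψ : F[X] →ₗ[F] F) (a b n : ℕ) : Submodule F F[X] :=
  degreeLT F n ⊓ (shiftAnnihilator φ a ⊓ shiftAnnihilator ψ b)

theorem mem_jointAnnihilator {f : F[X]} : f ∈ jointAnnihilator φ ψ a b n ↔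
    f.degree < n ∧ f ∈ shiftAnnihilator φ a ∧ f ∈ shiftAnnihilator ψ b := by
  simp [jointAnnihilator, mem_degreeLT]

theorem mem_jointAnnihilator_succ (ha : 0 < a) (hb : 0 < b) {f : F[X]} :
    f ∈ jointAnnihilator φ ψ (a + 1) (b + 1) n ↔
      f ∈ jointAnnihilator φ ψ a b (n + 1) ∧ X * f ∈ jointAnnihilator φ ψ a b (n + 1) := by
  have hdeg : f.degree < n ↔
      f.degree < ((n + 1 : ℕ) : WithBot ℕ) ∧ (X * f : F[X]).degree < ((n + 1 : ℕ) : WithBot ℕ) := by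
    by_cases h0 : f = 0
    · simp [h0]
    · have hX : X * f ≠ 0 := mul_ne_zero X_ne_zero h0
      rw [← natDegree_lt_iff_degree_lt h0, ← natDegree_lt_iff_degree_lt h0,
        ← natDegree_lt_iff_degree_lt hX, natDegree_X_mul h0]
      omega
  simp only [mem_jointAnnihilator, mem_shiftAnnihilator_succ ha, mem_shiftAnnihilator_succ hb, hdeg]
  tauto

/-- A nonzero joint annihilator consists of all multiples, up to a degree bound, of one
polynomial. -/
theorem exists_generator_jointAnnihilator (ha : n < a) (hb : n < b)
    (hV : jointAnnihilator φ ψ a b (n + 1) ≠ ⊥) :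
    ∃ g : F[X], g ≠ 0 ∧ ∃ e : ℕ, ∀ f : F[X], f ∈ jointAnnihilator φ ψ a b (n + 1) ↔
      ∃ h : F[X], h.degree < (e + 1 : ℕ) ∧ g * h = f := by
  classical
  set V := jointAnnihilator φ ψ a b (n + 1) with hVdef
  obtain ⟨f₀, hf₀, hf₀0⟩ := (Submodule.ne_bot_iff _).1 hV
  have hle : ∀ f ∈ V, f.natDegree ≤ n := fun f hf => by
    by_cases h0 : f = 0
    · simp [h0]
    · exact Nat.lt_succ_iff.1
        ((natDegree_lt_iff_degree_lt h0).2 (mem_jointAnnihilator.1 hf).1)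
  have hmin : ∃ d, ∃ f ∈ V, f ≠ 0 ∧ f.natDegree = d := ⟨_, f₀, hf₀, hf₀0, rfl⟩
  obtain ⟨g, hg, hg0, hgd⟩ := Nat.find_spec hmin
  have hgmin : ∀ f ∈ V, f ≠ 0 → g.natDegree ≤ f.natDegree := fun f hf h0 => by
    rw [hgd]; exact Nat.find_min' hmin ⟨f, hf, h0, rfl⟩
  have hdvd : ∀ f ∈ V, g ∣ f := fun f hf => by
    obtain ⟨A, hA⟩ := EuclideanDomain.gcd_dvd_left f g
    obtain ⟨B, hB⟩ := EuclideanDomain.gcd_dvd_right f g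
    set c := EuclideanDomain.gcd f g with hc
    have hc0 : c ≠ 0 := by
      intro h; rw [h, zero_mul] at hB; exact hg0 hB
    have hB0 : B ≠ 0 := by
      rintro rfl; rw [mul_zero] at hB; exact hg0 hB
    have hcop : IsCoprime A B := by
      refine ⟨EuclideanDomain.gcdA f g, EuclideanDomain.gcdB f g, mul_left_cancel₀ hc0 ?_⟩
      have := EuclideanDomain.gcd_eq_gcd_ab f g
      rw [← hc] at this
      linear_combination -this - EuclideanDomain.gcdA f g * hA - EuclideanDomain.gcdB f g * hB
    have hAn : A.natDegree ≤ n := by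
      by_cases h0 : A = 0
      · simp [h0]
      have := hle f hf
      rw [hA, natDegree_mul hc0 h0] at this
      omega
    have hgdeg : g.natDegree = c.natDegree + B.natDegree := by
      conv_lhs => rw [hB]
      exact natDegree_mul hc0 hB0
    have hgn := hle g hg
    have hf' := mem_jointAnnihilator.1 hf
    have hg' := mem_jointAnnihilator.1 hg
    have hcV : c ∈ V := by
      refine mem_jointAnnihilator.2 ⟨?_, ?_, ?_⟩
      · rw [← natDegree_lt_iff_degree_lt hc0]; omega
      · exact mem_shiftAnnihilator_of_isCoprime (hA ▸ hf'.2.1) (hB ▸ hg'.2.1) hcop hB0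
          (by omega) (by omega)
      · exact mem_shiftAnnihilator_of_isCoprime (hA ▸ hf'.2.2) (hB ▸ hg'.2.2) hcop hB0
          (by omega) (by omega)
    have hBdeg : B.natDegree = 0 := by
      have := hgmin c hcV hc0
      omega
    have hBu : IsUnit B := isUnit_iff_degree_eq_zero.2 (by
      rw [degree_eq_natDegree hB0, hBdeg]; rfl)
    have hgc : g ∣ c := by
      conv_lhs => rw [hB]
      exact (hBu.mul_right_dvd).2 dvd_rfl
    exact hgc.trans (Dvd.intro _ hA.symm)
  obtain ⟨P, hP, hPmax⟩ : ∃ P ∈ V, P ≠ 0 ∧ ∀ f ∈ V, f.natDegree ≤ P.natDegree := by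
    have hbd : ∀ d, (∃ f ∈ V, f ≠ 0 ∧ f.natDegree = d) → d ≤ n := by
      rintro d ⟨f, hf, -, rfl⟩; exact hle f hf
    obtain ⟨P, hP, hP0, hPd⟩ := Nat.findGreatest_spec
      (P := fun d => ∃ f ∈ V, f ≠ 0 ∧ f.natDegree = d) (hbd _ hmin.choose_spec) hmin.choose_spec
    refine ⟨P, hP, hP0, fun f hf => ?_⟩
    by_cases h0 : f = 0
    · simp [h0]
    rw [hPd]
    exact Nat.le_findGreatest (hle f hf) ⟨f, hf, h0, rfl⟩
  obtain ⟨hP0, hPmax⟩ := hPmax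
  obtain ⟨A, rfl⟩ := hdvd P hP
  have hA0 : A ≠ 0 := right_ne_zero_of_mul hP0
  have hPn := hle _ hP
  rw [natDegree_mul hg0 hA0] at hPn
  refine ⟨g, hg0, A.natDegree, fun f => ⟨fun hf => ?_, ?_⟩⟩
  · obtain ⟨h, rfl⟩ := hdvd f hf
    refine ⟨h, ?_, rfl⟩
    by_cases h0 : h = 0
    · rw [h0, degree_zero]; exact WithBot.bot_lt_coe _
    have := hPmax _ hf
    rw [natDegree_mul hg0 hA0, natDegree_mul hg0 h0] at this
    rw [← natDegree_lt_iff_degree_lt h0]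
    omega
  · rintro ⟨h, hh, rfl⟩
    by_cases h0 : h = 0
    · rw [h0, mul_zero]; exact V.zero_mem
    rw [← natDegree_lt_iff_degree_lt h0] at hh
    have hP' := mem_jointAnnihilator.1 hP
    have hg' := mem_jointAnnihilator.1 hg
    refine mem_jointAnnihilator.2 ⟨?_, ?_, ?_⟩
    · rw [← natDegree_lt_iff_degree_lt (mul_ne_zero hg0 h0), natDegree_mul hg0 h0]
      omega
    · exact mul_mem_shiftAnnihilator hg'.2.1 hP'.2.1 hA0 (by omega) (by omega)
    · exact mul_mem_shiftAnnihilator hg'.2.2 hP'.2.2 hA0 (by omega) (by omega)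

theorem natCard_degreeLT [Finite F] (n : ℕ) : Nat.card (degreeLT F n) = Nat.card F ^ n := by
  rw [Nat.card_congr (degreeLTEquiv F n).toEquiv, Nat.card_fun, Nat.card_fin]

theorem natCard_jointAnnihilator_of_ne_bot [Finite F] (ha : n < a) (hb : n < b)
    (hV : jointAnnihilator φ ψ a b (n + 1) ≠ ⊥) :
    Nat.card (jointAnnihilator φ ψ a b (n + 1)) =
      Nat.card F * Nat.card (jointAnnihilator φ ψ (a + 1) (b + 1) n) := by
  obtain ⟨g, hg0, e, hmem⟩ := exists_generator_jointAnnihilator ha hb hV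
  have hinj : Function.Injective (LinearMap.mulLeft F g) := mul_right_injective₀ hg0
  have hV' : jointAnnihilator φ ψ a b (n + 1) =
      (degreeLT F (e + 1)).map (LinearMap.mulLeft F g) := by
    ext f
    simp [hmem, mem_degreeLT]
  have hW' : jointAnnihilator φ ψ (a + 1) (b + 1) n =
      (degreeLT F e).map (LinearMap.mulLeft F g) := by
    ext f
    simp only [mem_jointAnnihilator_succ (show 0 < a by omega) (show 0 < b by omega), hmem,
      Submodule.mem_map, mem_degreeLT, LinearMap.mulLeft_apply]
    have hX : ∀ h : F[X], h.degree < e ↔ (X * h : F[X]).degree < ((e + 1 : ℕ) : WithBot ℕ) := fun h => by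
      by_cases h0 : h = 0
      · simp [h0]
      rw [← natDegree_lt_iff_degree_lt h0,
        ← natDegree_lt_iff_degree_lt (mul_ne_zero X_ne_zero h0), natDegree_X_mul h0]
      omega
    constructor
    · rintro ⟨⟨h, -, rfl⟩, h', hh', heq⟩
      refine ⟨h, ?_, rfl⟩
      have : h' = X * h := mul_left_cancel₀ hg0 (by rw [heq]; ring)
      rw [hX, ← this]
      exact hh'
    · rintro ⟨h, hh, rfl⟩
      refine ⟨⟨h, hh.trans (by exact_mod_cast Nat.lt_succ_self e), rfl⟩, X * h, (hX h).1 hh, by ring⟩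
  have hcard : ∀ N, Nat.card ((degreeLT F N).map (LinearMap.mulLeft F g)) = Nat.card F ^ N := by
    intro N
    rw [← natCard_degreeLT N]
    exact (Nat.card_congr (Submodule.equivMapOfInjective _ hinj _).toEquiv).symm
  rw [hV', hW', hcard, hcard, pow_succ']

end ShiftAnnihilator

/-- The functional on polynomials sending `X ^ n` to `α n` for `n < N` and to `0` otherwise. -/
noncomputable def seqFunctional {F : Type*} [Field F] {N : ℕ} (α : Fin N → F) : F[X] →ₗ[F] F :=
  ∑ n : Fin N, α n • lcoeff F (n : ℕ)

section SeqFunctional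

variable {F : Type*} [Field F] {N : ℕ}

theorem seqFunctional_apply (α : Fin N → F) (f : F[X]) :
    seqFunctional α f = ∑ n : Fin N, α n * f.coeff n := by
  simp [seqFunctional]

theorem seqFunctional_monomial (α : Fin N → F) {n : ℕ} (hn : n < N) (c : F) :
    seqFunctional α (monomial n c) = α ⟨n, hn⟩ * c := by
  rw [seqFunctional_apply, Finset.sum_eq_single ⟨n, hn⟩]
  · simp
  · intro j _ hj
    rw [coeff_monomial, if_neg, mul_zero]
    exact fun h => hj (Fin.ext h.symm)
  · simp

/-- A nonzero polynomial is annihilated by the first `a` shifts of exactly `|F| ^ (N - a)`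
sequences of length `N`. -/
theorem natCard_seq_mem_shiftAnnihilator [Finite F] {f : F[X]} (hf : f ≠ 0) {a : ℕ}
    (hN : f.natDegree + a ≤ N) :
    Nat.card {α : Fin N → F // f ∈ shiftAnnihilator (seqFunctional α) a} =
      Nat.card F ^ (N - a) := by
  set M : Matrix (Fin a) (Fin N) F := Matrix.of fun i n => (X ^ (i : ℕ) * f).coeff n with hM
  have hrow : LinearIndependent F M.row := by
    rw [Fintype.linearIndependent_iff]
    intro c hc
    set p : F[X] := ∑ i : Fin a, monomial (i : ℕ) (c i) with hp
    have hpcoeff : ∀ i : Fin a, p.coeff i = c i := fun i => by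
      simp only [hp, finsetSum_coeff, coeff_monomial]
      rw [Finset.sum_eq_single i]
      · simp
      · intro j _ hj
        rw [if_neg]
        exact fun h => hj (Fin.ext h)
      · simp
    have hprod : p * f = ∑ i : Fin a, c i • (X ^ (i : ℕ) * f) := by
      rw [hp, Finset.sum_mul]
      refine Finset.sum_congr rfl fun i _ => ?_
      rw [← C_mul_X_pow_eq_monomial, smul_eq_C_mul, mul_assoc]
    have hpf : p * f = 0 := by
      ext n
      rw [coeff_zero]
      by_cases hn : n < N
      · have := congrFun hc ⟨n, hn⟩
        rw [hprod, finsetSum_coeff]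
        simpa [hM, Matrix.row, Finset.sum_apply] using this
      · rw [hprod, finsetSum_coeff]
        refine Finset.sum_eq_zero fun i _ => ?_
        rw [coeff_smul, coeff_eq_zero_of_natDegree_lt, smul_zero]
        have h2 : (X ^ (i : ℕ) * f).natDegree ≤ (X ^ (i : ℕ) : F[X]).natDegree + f.natDegree :=
          natDegree_mul_le
        rw [natDegree_X_pow] at h2
        have := i.isLt
        omega
    have hp0 : p = 0 := (mul_eq_zero.1 hpf).resolve_right hf
    intro i
    rw [← hpcoeff i, hp0, coeff_zero]
  have hker : ∀ α : Fin N → F,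
      f ∈ shiftAnnihilator (seqFunctional α) a ↔ α ∈ LinearMap.ker M.mulVecLin := fun α => by
    rw [LinearMap.mem_ker, Matrix.mulVecLin_apply, mem_shiftAnnihilator]
    simp only [funext_iff, Matrix.mulVec, dotProduct, hM, Matrix.of_apply, Pi.zero_apply,
      seqFunctional_apply]
    constructor
    · intro h i
      rw [← h i i.isLt]
      exact Finset.sum_congr rfl fun _ _ => mul_comm _ _
    · intro h i hi
      rw [← h ⟨i, hi⟩]
      exact Finset.sum_congr rfl fun _ _ => mul_comm _ _
  have hrank : M.rank = a := by rw [hrow.rank_matrix, Fintype.card_fin]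
  have hfin : Module.finrank F (LinearMap.ker M.mulVecLin) = N - a := by
    have h1 := LinearMap.finrank_range_add_finrank_ker M.mulVecLin
    rw [Module.finrank_fin_fun] at h1
    rw [Matrix.rank] at hrank
    omega
  rw [Nat.card_congr (Equiv.subtypeEquivRight hker)]
  rw [← hfin]
  exact Module.natCard_eq_pow_finrank

/-- Double counting of pairs of sequences together with a polynomial they both annihilate. -/
theorem sum_natCard_jointAnnihilator [Fintype F] {L a b n : ℕ}
    (ha : n + a ≤ N + 1) (hb : n + b ≤ L + 1) :
    ∑ p : (Fin N → F) × (Fin L → F),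
        Nat.card (jointAnnihilator (seqFunctional p.1) (seqFunctional p.2) a b n) =
      Nat.card F ^ (N + L) + (Nat.card F ^ n - 1) * Nat.card F ^ ((N - a) + (L - b)) := by
  classical
  have : Fintype (degreeLT F n) := Fintype.ofEquiv _ (degreeLTEquiv F n).symm.toEquiv
  have h1 : ∀ p : (Fin N → F) × (Fin L → F),
      Nat.card (jointAnnihilator (seqFunctional p.1) (seqFunctional p.2) a b n) =
      Nat.card {f : degreeLT F n // (f : F[X]) ∈ shiftAnnihilator (seqFunctional p.1) a ∧
        (f : F[X]) ∈ shiftAnnihilator (seqFunctional p.2) b} := fun p =>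
    Nat.card_congr (Equiv.subtypeSubtypeEquivSubtypeInter (fun f : F[X] => f ∈ degreeLT F n)
      (fun f => f ∈ shiftAnnihilator (seqFunctional p.1) a ∧
        f ∈ shiftAnnihilator (seqFunctional p.2) b)).symm
  have h2 : ∀ f : degreeLT F n,
      Nat.card {p : (Fin N → F) × (Fin L → F) //
        (f : F[X]) ∈ shiftAnnihilator (seqFunctional p.1) a ∧
        (f : F[X]) ∈ shiftAnnihilator (seqFunctional p.2) b} =
      if f = 0 then Nat.card F ^ (N + L) else Nat.card F ^ ((N - a) + (L - b)) := fun f => by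
    split_ifs with h0
    · subst h0
      simp [pow_add]
    · have hf0 : (f : F[X]) ≠ 0 := fun h => h0 (Subtype.ext h)
      have hdeg := (natDegree_lt_iff_degree_lt hf0).2 (mem_degreeLT.1 f.2)
      rw [Nat.card_congr (Equiv.subtypeProdEquivProd
        (p := fun α : Fin N → F => (f : F[X]) ∈ shiftAnnihilator (seqFunctional α) a)
        (q := fun β : Fin L → F => (f : F[X]) ∈ shiftAnnihilator (seqFunctional β) b)),
        Nat.card_prod, natCard_seq_mem_shiftAnnihilator hf0 (by omega),
        natCard_seq_mem_shiftAnnihilator hf0 (by omega), pow_add]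
  have h3 : ∑ p : (Fin N → F) × (Fin L → F),
      Nat.card {f : degreeLT F n // (f : F[X]) ∈ shiftAnnihilator (seqFunctional p.1) a ∧
        (f : F[X]) ∈ shiftAnnihilator (seqFunctional p.2) b} =
      ∑ f : degreeLT F n, Nat.card {p : (Fin N → F) × (Fin L → F) //
        (f : F[X]) ∈ shiftAnnihilator (seqFunctional p.1) a ∧
        (f : F[X]) ∈ shiftAnnihilator (seqFunctional p.2) b} := by
    simp only [Nat.card_eq_fintype_card, Fintype.card_subtype]
    exact Finset.sum_card_bipartiteAbove_eq_sum_card_bipartiteBelow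
      (fun (p : (Fin N → F) × (Fin L → F)) (f : degreeLT F n) =>
        (f : F[X]) ∈ shiftAnnihilator (seqFunctional p.1) a ∧
        (f : F[X]) ∈ shiftAnnihilator (seqFunctional p.2) b)
  rw [Finset.sum_congr rfl fun p _ => h1 p, h3, Finset.sum_congr rfl fun f _ => h2 f,
    ← Finset.add_sum_erase _ _ (Finset.mem_univ (0 : degreeLT F n)), if_pos rfl,
    Finset.sum_congr rfl fun f hf => if_neg (Finset.ne_of_mem_erase hf), Finset.sum_const,
    Finset.card_erase_of_mem (Finset.mem_univ _), Finset.card_univ, ← Nat.card_eq_fintype_card,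
    natCard_degreeLT, smul_eq_mul]

end SeqFunctional

theorem hankel_mulVec_degreeLTEquiv {a k : ℕ} (α : Fin (a + k - 1) → ZMod 2)
    (f : degreeLT (ZMod 2) k) (i : Fin a) :
    (hankel a k α *ᵥ degreeLTEquiv (ZMod 2) k f) i =
      seqFunctional α (X ^ (i : ℕ) * (f : (ZMod 2)[X])) := by
  have hf : (f : (ZMod 2)[X]) = ∑ j : Fin k, monomial (j : ℕ) (degreeLTEquiv (ZMod 2) k f j) := by
    conv_lhs => rw [← (degreeLTEquiv (ZMod 2) k).symm_apply_apply f]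
    rfl
  conv_rhs => rw [hf]
  rw [Finset.mul_sum, map_sum, Matrix.mulVec, dotProduct]
  refine Finset.sum_congr rfl fun j _ => ?_
  have hj := j.isLt
  have hi := i.isLt
  rw [X_pow_mul_monomial, seqFunctional_monomial α (show (j : ℕ) + i < a + k - 1 by omega)]
  simp [hankel, add_comm]

theorem rank_fromRows_hankel_eq_iff {a b k : ℕ} (α : Fin (a + k - 1) → ZMod 2)
    (β : Fin (b + k - 1) → ZMod 2) :
    (Matrix.fromRows (hankel a k α) (hankel b k β)).rank = k ↔
      jointAnnihilator (seqFunctional α) (seqFunctional β) a b k = ⊥ := by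
  set M := Matrix.fromRows (hankel a k α) (hankel b k β) with hM
  have hker : ∀ f : degreeLT (ZMod 2) k, M *ᵥ degreeLTEquiv (ZMod 2) k f = 0 ↔
      (f : (ZMod 2)[X]) ∈ jointAnnihilator (seqFunctional α) (seqFunctional β) a b k := fun f => by
    rw [mem_jointAnnihilator, ← mem_degreeLT, hM, Matrix.fromRows_mulVec]
    rw [and_iff_right f.2]
    simp only [mem_shiftAnnihilator, funext_iff, Sum.forall, Sum.elim_inl,
      Sum.elim_inr, hankel_mulVec_degreeLTEquiv, Pi.zero_apply, Fin.forall_iff]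
  have hrank : M.rank = k ↔ LinearMap.ker M.mulVecLin = ⊥ := by
    have h1 := LinearMap.finrank_range_add_finrank_ker M.mulVecLin
    rw [Module.finrank_fin_fun] at h1
    rw [← Submodule.finrank_eq_zero (S := LinearMap.ker M.mulVecLin), Matrix.rank]
    omega
  rw [hrank, Submodule.eq_bot_iff, Submodule.eq_bot_iff]
  constructor
  · intro h f hf
    have hfk : f ∈ degreeLT (ZMod 2) k := mem_degreeLT.2 (mem_jointAnnihilator.1 hf).1
    have := h (degreeLTEquiv (ZMod 2) k ⟨f, hfk⟩) ((hker ⟨f, hfk⟩).2 hf)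
    rw [LinearEquiv.map_eq_zero_iff] at this
    exact congrArg Subtype.val this
  · intro h x hx
    obtain ⟨f, rfl⟩ := (degreeLTEquiv (ZMod 2) k).surjective x
    have := h f ((hker f).1 hx)
    rw [Subtype.ext this (a2 := (0 : degreeLT (ZMod 2) k)), map_zero]

theorem Gamma_full_column_rank (s m k : ℕ) (hs : 2 ≤ s) (hk1 : 1 ≤ k) (hk2 : k ≤ s) :
    (8 : ℤ) * Gamma s (s + m) k k = 2 ^ (2 * k + 2 * s + m + 1) - 3 * 2 ^ (3 * k - 1) + 2 ^ (2 * k) := by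
  classical
  obtain ⟨n, rfl⟩ : ∃ n, k = n + 1 := ⟨k - 1, by omega⟩
  let V (p : (Fin (s + (n + 1) - 1) → ZMod 2) × (Fin (s + m + (n + 1) - 1) → ZMod 2)) :=
    jointAnnihilator (seqFunctional p.1) (seqFunctional p.2) s (s + m) (n + 1)
  let W (p : (Fin (s + (n + 1) - 1) → ZMod 2) × (Fin (s + m + (n + 1) - 1) → ZMod 2)) :=
    jointAnnihilator (seqFunctional p.1) (seqFunctional p.2) (s + 1) (s + m + 1) n
  have hind : ∀ p, (if V p = ⊥ then 1 else 0 : ℤ) = 2 * Nat.card (W p) - Nat.card (V p) := by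
    intro p
    split_ifs with h
    · have hW : W p = ⊥ := by
        rw [Submodule.eq_bot_iff] at h ⊢
        exact fun f hf => h f ((mem_jointAnnihilator_succ (by omega) (by omega)).1 hf).1
      rw [h, hW]
      simp
    · have := natCard_jointAnnihilator_of_ne_bot (n := n) (a := s) (b := s + m) (by omega)
        (by omega) h
      rw [Nat.card_zmod] at this
      simp only [V, W]
      rw [this]
      push_cast
      ring
  have hGamma : (Gamma s (s + m) (n + 1) (n + 1) : ℤ) =
      2 * (∑ p, Nat.card (W p) : ℕ) - (∑ p, Nat.card (V p) : ℕ) := by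
    have hcard : Gamma s (s + m) (n + 1) (n + 1) = Nat.card {p // V p = ⊥} :=
      Nat.card_congr (Equiv.subtypeEquivRight fun p => rank_fromRows_hankel_eq_iff p.1 p.2)
    rw [hcard, Nat.card_eq_fintype_card, Fintype.card_subtype, Finset.card_filter]
    clear_value V W
    push_cast
    rw [Finset.mul_sum, ← Finset.sum_sub_distrib]
    exact Finset.sum_congr rfl fun p _ => hind p
  have hV := sum_natCard_jointAnnihilator (F := ZMod 2) (N := s + (n + 1) - 1)
    (L := s + m + (n + 1) - 1) (a := s) (b := s + m) (n := n + 1) (by omega) (by omega)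
  have hW := sum_natCard_jointAnnihilator (F := ZMod 2) (N := s + (n + 1) - 1)
    (L := s + m + (n + 1) - 1) (a := s + 1) (b := s + m + 1) (n := n) (by omega) (by omega)
  rw [hGamma]
  simp only [V, W]
  rw [hV, hW, Nat.card_zmod]
  have e1 : s + (n + 1) - 1 - s + (s + m + (n + 1) - 1 - (s + m)) = 2 * n := by omega
  have e2 : s + (n + 1) - 1 + (s + m + (n + 1) - 1) = 2 * s + m + 2 * n := by omega
  have e3 : 3 * (n + 1) - 1 = 3 * n + 2 := by omega
  rw [e1, e2, e3]
  rcases n with _ | n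
  · simp
    ring
  · have e4 : s + (n + 1 + 1) - 1 - (s + 1) + (s + m + (n + 1 + 1) - 1 - (s + m + 1)) = 2 * n := by
      omega
    rw [e4]
    push_cast [Nat.one_le_two_pow]
    ring
end

section
/- Let s ≥ 2 and k > s. Then Γ_s^{[s,s]×k} = 3·2^{k+s−1} + 21·2^{3s−4} − 27·2^{2s−3}. -/
open Matrix

open Polynomial

section Convex

variable {N : ℕ} {f : ℕ → ℕ}

lemma add_le_succ_of_convex (hf : ∀ j, j + 2 ≤ N → 2 * f (j + 1) ≤ f j + f (j + 2))
    {j c : ℕ} (h : f j + c ≤ f (j + 1)) (t : ℕ) (ht : j + t + 1 ≤ N) :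
    f (j + t) + c ≤ f (j + t + 1) := by
  induction t with
  | zero => simpa using h
  | succ t ih =>
    have h1 := ih (by omega)
    have h2 : 2 * f (j + t + 1) ≤ f (j + t) + f (j + t + 1 + 1) := hf (j + t) (by omega)
    have e : j + (t + 1) = j + t + 1 := by omega
    rw [e]
    omega

lemma add_mul_le_of_convex (hf : ∀ j, j + 2 ≤ N → 2 * f (j + 1) ≤ f j + f (j + 2))
    {j c : ℕ} (h : f j + c ≤ f (j + 1)) (t : ℕ) (ht : j + t ≤ N) :
    f j + c * t ≤ f (j + t) := by
  induction t with
  | zero => simp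
  | succ t ih =>
    have h1 := ih (by omega)
    have h2 := add_le_succ_of_convex hf h t (by omega)
    rw [mul_add, ← add_assoc j]
    omega

lemma last_slope_of_convex (hf : ∀ j, j + 2 ≤ N → 2 * f (j + 1) ≤ f j + f (j + 2))
    {a c : ℕ} (t : ℕ) (ht : a + t + 1 ≤ N) (h : f a + c * (t + 1) < f (a + t + 1)) :
    f (a + t) + (c + 1) ≤ f (a + t + 1) := by
  induction t with
  | zero => simp at h ⊢; omega
  | succ t ih =>
    by_cases h1 : f a + c * (t + 1) < f (a + t + 1)
    · have h2 := ih (by omega) h1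
      have h3 : 2 * f (a + t + 1) ≤ f (a + t) + f (a + t + 1 + 1) := hf (a + t) (by omega)
      have e : a + (t + 1) = a + t + 1 := by omega
      rw [e]
      omega
    · rw [mul_add] at h
      have e : a + (t + 1) = a + t + 1 := by omega
      rw [e] at h ⊢
      omega

end Convex

section Annihilator

variable {ι : Type*} {N : ℕ}

/-- The linear functional on polynomials sending `X ^ i` to `α i` for `i < N` and to `0`
otherwise. -/
noncomputable def pairing (α : Fin N → ZMod 2) : (ZMod 2)[X] →ₗ[ZMod 2] ZMod 2 :=
  ∑ i, α i • lcoeff (ZMod 2) i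

lemma pairing_apply (α : Fin N → ZMod 2) (p : (ZMod 2)[X]) :
    pairing α p = ∑ i, α i * p.coeff i := by
  simp [pairing]

/-- The polynomials `u` of degree `< j` such that every functional of the family `A` vanishes
on all multiples `f * u` with `f` of degree `≤ N - j`. -/
def annihilator (A : ι → Fin N → ZMod 2) (j : ℕ) : Submodule (ZMod 2) (ZMod 2)[X] where
  carrier := {u | u ∈ degreeLT (ZMod 2) j ∧ ∀ a i, i + j ≤ N → pairing (A a) (X ^ i * u) = 0}
  add_mem' := by
    rintro u v ⟨hu, hu'⟩ ⟨hv, hv'⟩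
    refine ⟨add_mem hu hv, fun a i h => ?_⟩
    rw [mul_add, map_add, hu' a i h, hv' a i h, add_zero]
  zero_mem' := ⟨zero_mem _, by simp⟩
  smul_mem' := by
    rintro c u ⟨hu, hu'⟩
    refine ⟨Submodule.smul_mem _ _ hu, fun a i h => ?_⟩
    rw [mul_smul_comm, map_smul, hu' a i h, smul_zero]

lemma mem_annihilator {A : ι → Fin N → ZMod 2} {j : ℕ} {u : (ZMod 2)[X]} :
    u ∈ annihilator A j ↔
      u ∈ degreeLT (ZMod 2) j ∧ ∀ a i, i + j ≤ N → pairing (A a) (X ^ i * u) = 0 := Iff.rfl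

instance (j : ℕ) : FiniteDimensional (ZMod 2) (degreeLT (ZMod 2) j) :=
  (degreeLTEquiv (ZMod 2) j).symm.finiteDimensional

lemma annihilator_le_degreeLT (A : ι → Fin N → ZMod 2) (j : ℕ) :
    annihilator A j ≤ degreeLT (ZMod 2) j := fun _ h => h.1

instance (A : ι → Fin N → ZMod 2) (j : ℕ) : FiniteDimensional (ZMod 2) (annihilator A j) :=
  Submodule.finiteDimensional_of_le (annihilator_le_degreeLT A j)

/-- The dimension of the space of common annihilators of degree `< j`. -/
noncomputable def nullity (A : ι → Fin N → ZMod 2) (j : ℕ) : ℕ :=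
  Module.finrank (ZMod 2) (annihilator A j)

lemma finrank_degreeLT (j : ℕ) : Module.finrank (ZMod 2) (degreeLT (ZMod 2) j) = j := by
  rw [(degreeLTEquiv (ZMod 2) j).finrank_eq, Module.finrank_fin_fun]

lemma nullity_le (A : ι → Fin N → ZMod 2) (j : ℕ) : nullity A j ≤ j :=
  (Submodule.finrank_mono (annihilator_le_degreeLT A j)).trans_eq (finrank_degreeLT j)

lemma X_mul_mem_degreeLT_s6 {j : ℕ} {u : (ZMod 2)[X]} :
    X * u ∈ degreeLT (ZMod 2) (j + 1) ↔ u ∈ degreeLT (ZMod 2) j := by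
  rw [mem_degreeLT, mem_degreeLT, degree_lt_iff_coeff_zero, degree_lt_iff_coeff_zero]
  constructor
  · intro h m hm
    simpa using h (m + 1) (by omega)
  · rintro h (_ | m) hm
    · omega
    · simpa using h m (by omega)

lemma annihilator_le_succ (A : ι → Fin N → ZMod 2) (j : ℕ) :
    annihilator A j ≤ annihilator A (j + 1) := fun _ h =>
  ⟨degreeLT_mono (Nat.le_succ j) h.1, fun a i hi => h.2 a i (by omega)⟩

lemma X_mul_mem_annihilator {A : ι → Fin N → ZMod 2} {j : ℕ} {u : (ZMod 2)[X]}
    (h : u ∈ annihilator A j) : X * u ∈ annihilator A (j + 1) := by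
  refine ⟨X_mul_mem_degreeLT_s6.2 h.1, fun a i hi => ?_⟩
  rw [← mul_assoc, ← pow_succ]
  exact h.2 a (i + 1) (by omega)

lemma mem_annihilator_of_X_mul_mem {A : ι → Fin N → ZMod 2} {j : ℕ} {u : (ZMod 2)[X]}
    (hj : j + 1 ≤ N) (h : u ∈ annihilator A (j + 1)) (hX : X * u ∈ annihilator A (j + 1)) :
    u ∈ annihilator A j := by
  refine ⟨X_mul_mem_degreeLT_s6.1 hX.1, fun a i hi => ?_⟩
  rcases i with _ | i
  · exact h.2 a 0 (by omega)
  · rw [pow_succ, mul_assoc]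
    exact hX.2 a i (by omega)

lemma nullity_convex (A : ι → Fin N → ZMod 2) {j : ℕ} (hj : j + 2 ≤ N) :
    2 * nullity A (j + 1) ≤ nullity A j + nullity A (j + 2) := by
  let T : (ZMod 2)[X] →ₗ[ZMod 2] (ZMod 2)[X] := LinearMap.mulLeft (ZMod 2) X
  have hT : Function.Injective T := fun u v h => mul_left_cancel₀ X_ne_zero h
  have hmap (i : ℕ) : Module.finrank (ZMod 2) ((annihilator A i).map T) = nullity A i :=
    (Submodule.equivMapOfInjective T hT _).finrank_eq.symm
  have h1 := Submodule.finrank_sup_add_finrank_inf_eq (annihilator A (j + 1))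
    ((annihilator A (j + 1)).map T)
  have h2 : annihilator A (j + 1) ⊔ (annihilator A (j + 1)).map T ≤ annihilator A (j + 2) := by
    refine sup_le (annihilator_le_succ A _) ?_
    rintro _ ⟨u, hu, rfl⟩
    exact X_mul_mem_annihilator hu
  have h3 : annihilator A (j + 1) ⊓ (annihilator A (j + 1)).map T ≤ (annihilator A j).map T := by
    rintro _ ⟨hX, u, hu, rfl⟩
    exact ⟨u, mem_annihilator_of_X_mul_mem (by omega) hu hX, rfl⟩
  have h4 := Submodule.finrank_mono h2
  have h5 := Submodule.finrank_mono h3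
  rw [hmap] at h1 h5
  simp only [nullity] at *
  omega

lemma nullity_zero (A : ι → Fin N → ZMod 2) : nullity A 0 = 0 :=
  Nat.le_zero.1 (nullity_le A 0)

lemma eq_zero_of_nullity {A : ι → Fin N → ZMod 2} (h : N ≤ nullity A N) : A = 0 := by
  have h1 : annihilator A N = degreeLT (ZMod 2) N :=
    Submodule.eq_of_le_of_finrank_le (annihilator_le_degreeLT A N)
      ((finrank_degreeLT N).trans_le h)
  funext a i
  have h2 : (X : (ZMod 2)[X]) ^ (i : ℕ) ∈ annihilator A N := by
    rw [h1, mem_degreeLT, degree_X_pow]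
    exact_mod_cast i.isLt
  have h3 := h2.2 a 0 (by omega)
  simpa [pairing_apply, coeff_X_pow, Fin.val_inj] using h3

lemma nullity_zero_family (j : ℕ) : nullity (0 : ι → Fin N → ZMod 2) j = j := by
  have : annihilator (0 : ι → Fin N → ZMod 2) j = degreeLT (ZMod 2) j :=
    le_antisymm (annihilator_le_degreeLT _ _) fun u hu => ⟨hu, by simp [pairing_apply]⟩
  rw [nullity, this, finrank_degreeLT]

lemma nullity_succ_le (A : ι → Fin N → ZMod 2) {j : ℕ} (hj : 2 * j ≤ N) (hN : j < N) :
    nullity A (j + 1) ≤ nullity A j + 1 := by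
  by_contra! h
  have h1 := add_mul_le_of_convex (fun _ => nullity_convex A) (c := 2) h (N - j) (by omega)
  rw [Nat.add_sub_cancel' hN.le] at h1
  have h2 : A = 0 := eq_zero_of_nullity (by omega)
  subst h2
  simp only [nullity_zero_family] at h
  omega

lemma nullity_succ (A : ι → Fin N → ZMod 2) {j : ℕ} (hj : 2 * j ≤ N) (hN : j < N)
    (h : nullity A (j + 1) ≠ 0) : nullity A (j + 1) = nullity A j + 1 := by
  refine le_antisymm (nullity_succ_le A hj hN) ?_
  have := last_slope_of_convex (fun _ => nullity_convex A) (a := 0) (c := 0) j (by omega)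
    (by rw [nullity_zero]; simpa [Nat.pos_iff_ne_zero] using h)
  simpa using this

/-- The nullity of a family as the corank of a Hankel-type matrix. -/
lemma nullity_add_rank {m : Type*} [Fintype m] (A : ι → Fin N → ZMod 2) {j : ℕ}
    (M : Matrix m (Fin j) (ZMod 2))
    (hM : ∀ u ∈ degreeLT (ZMod 2) j, (∀ a i, i + j ≤ N → pairing (A a) (X ^ i * u) = 0) ↔
      M.mulVec (fun l => u.coeff l) = 0) :
    nullity A j + M.rank = j := by
  have h1 := LinearMap.finrank_range_add_finrank_ker M.mulVecLin
  rw [Module.finrank_fin_fun] at h1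
  have h2 : nullity A j = Module.finrank (ZMod 2) (LinearMap.ker M.mulVecLin) := by
    have h3 : (annihilator A j).comap (degreeLT (ZMod 2) j).subtype =
        (LinearMap.ker M.mulVecLin).comap (degreeLTEquiv (ZMod 2) j).toLinearMap := by
      ext u
      have := hM u u.2
      simp only [Submodule.mem_comap, Submodule.subtype_apply, mem_annihilator, u.2, true_and,
        this, LinearMap.mem_ker, Matrix.mulVecLin_apply]
      rfl
    rw [nullity, ← (Submodule.comapSubtypeEquivOfLe (annihilator_le_degreeLT A j)).finrank_eq, h3]
    exact ((degreeLTEquiv (ZMod 2) j).ofSubmodule' _).finrank_eq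
  rw [h2, add_comm]
  exact h1

lemma pairing_X_pow_mul (α : Fin N → ZMod 2) {i j : ℕ} (h : i + j ≤ N) {u : (ZMod 2)[X]}
    (hu : u ∈ degreeLT (ZMod 2) j) :
    pairing α (X ^ i * u) = ∑ l : Fin j, α ⟨i + l, by omega⟩ * u.coeff l := by
  rw [pairing_apply]
  symm
  refine Finset.sum_of_injOn (fun l : Fin j => (⟨i + l, by omega⟩ : Fin N)) ?_ ?_ ?_ ?_
  · intro l _ l' _ hl
    simpa [Fin.ext_iff] using hl
  · simp
  · intro n _ hn
    rw [coeff_X_pow_mul']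
    split_ifs with hin
    · rw [mem_degreeLT, degree_lt_iff_coeff_zero] at hu
      rw [hu, mul_zero]
      by_contra! hlt
      refine hn ⟨⟨n - i, hlt⟩, by simp, ?_⟩
      ext
      simp only
      omega
    · simp
  · intro l _
    simp [coeff_X_pow_mul']

end Annihilator

section Count

variable {ι : Type*} [Fintype ι] {N : ℕ}

lemma card_pairing_eq_zero {j : ℕ} (hj : j < N) {u : (ZMod 2)[X]} (hu : u ≠ 0)
    (hd : u ∈ degreeLT (ZMod 2) (j + 1)) :
    Nat.card {α : Fin N → ZMod 2 // ∀ i, i + (j + 1) ≤ N → pairing α (X ^ i * u) = 0} = 2 ^ j := by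
  let M : Matrix (Fin (N - j)) (Fin N) (ZMod 2) := Matrix.of fun i l => (X ^ (i : ℕ) * u).coeff l
  have hM (α : Fin N → ZMod 2) :
      (∀ i, i + (j + 1) ≤ N → pairing α (X ^ i * u) = 0) ↔ α ∈ LinearMap.ker M.mulVecLin := by
    rw [LinearMap.mem_ker, Matrix.mulVecLin_apply, funext_iff]
    have h (i : Fin (N - j)) : M.mulVec α i = pairing α (X ^ (i : ℕ) * u) := by
      simp [M, pairing_apply, Matrix.mulVec, dotProduct, mul_comm]
    exact ⟨fun H i => (h i).trans (H i (by omega)), fun H i hi => (h ⟨i, by omega⟩).symm.trans (H _)⟩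
  have hdeg (i : Fin (N - j)) : X ^ (i : ℕ) * u ∈ degreeLT (ZMod 2) N := by
    rw [mem_degreeLT, degree_lt_iff_coeff_zero] at hd ⊢
    intro m hm
    rw [coeff_X_pow_mul']
    split_ifs
    · exact hd _ (by omega)
    · rfl
  have hrow : LinearIndependent (ZMod 2) M.row := by
    have h1 : LinearIndependent (ZMod 2) fun i : Fin (N - j) => (X ^ (i : ℕ) * u : (ZMod 2)[X]) := by
      have h2 : LinearIndependent (ZMod 2) fun i : Fin (N - j) => (X ^ (i : ℕ) : (ZMod 2)[X]) := by
        have := (basisMonomials (ZMod 2)).linearIndependent.comp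
          (fun i : Fin (N - j) => (i : ℕ)) Fin.val_injective
        simpa [Function.comp_def, monomial_one_right_eq_X_pow] using this
      exact h2.map' (LinearMap.mulRight (ZMod 2) u)
        (LinearMap.ker_eq_bot.2 fun _ _ h => mul_right_cancel₀ hu h)
    have h3 : LinearIndependent (ZMod 2)
        fun i : Fin (N - j) => (⟨X ^ (i : ℕ) * u, hdeg i⟩ : degreeLT (ZMod 2) N) :=
      LinearIndependent.of_comp (degreeLT (ZMod 2) N).subtype h1
    exact h3.map' (degreeLTEquiv (ZMod 2) N).toLinearMap (LinearEquiv.ker _)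
  have hrank := hrow.rank_matrix
  have hsum := LinearMap.finrank_range_add_finrank_ker M.mulVecLin
  rw [Module.finrank_fin_fun] at hsum
  rw [Fintype.card_fin, Matrix.rank] at hrank
  rw [Nat.card_congr (Equiv.subtypeEquivRight hM)]
  change Nat.card (LinearMap.ker M.mulVecLin) = _
  rw [Module.natCard_eq_pow_finrank (K := ZMod 2), Nat.card_zmod]
  congr 1
  omega

lemma card_mem_annihilator {j : ℕ} (hj : j < N) {u : (ZMod 2)[X]} (hu : u ≠ 0)
    (hd : u ∈ degreeLT (ZMod 2) (j + 1)) :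
    Nat.card {A : ι → Fin N → ZMod 2 // u ∈ annihilator A (j + 1)} =
      (2 ^ j) ^ Fintype.card ι := by
  have e : {A : ι → Fin N → ZMod 2 // u ∈ annihilator A (j + 1)} ≃
      (ι → {α : Fin N → ZMod 2 // ∀ i, i + (j + 1) ≤ N → pairing α (X ^ i * u) = 0}) :=
    (Equiv.subtypeEquivRight fun A => by rw [mem_annihilator, and_iff_right hd]).trans
      Equiv.subtypePiEquivPi
  rw [Nat.card_congr e, Nat.card_fun, card_pairing_eq_zero hj hu hd, Nat.card_eq_fintype_card]

lemma natCard_degreeLT_s6 (j : ℕ) : Nat.card (degreeLT (ZMod 2) j) = 2 ^ j := by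
  rw [Module.natCard_eq_pow_finrank (K := ZMod 2), finrank_degreeLT, Nat.card_zmod]

lemma sum_two_pow_nullity [DecidableEq ι] {j : ℕ} (hj : j < N) :
    ∑ A : ι → Fin N → ZMod 2, 2 ^ nullity A (j + 1) =
      (2 ^ N) ^ Fintype.card ι + (2 ^ (j + 1) - 1) * (2 ^ j) ^ Fintype.card ι := by
  classical
  have : Finite (degreeLT (ZMod 2) (j + 1)) := Module.finite_of_finite (ZMod 2)
  have := Fintype.ofFinite (degreeLT (ZMod 2) (j + 1))
  have h1 (A : ι → Fin N → ZMod 2) :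
      2 ^ nullity A (j + 1) =
        Nat.card {u : degreeLT (ZMod 2) (j + 1) // u.1 ∈ annihilator A (j + 1)} := by
    have h := Nat.card_congr
      (Submodule.comapSubtypeEquivOfLe (annihilator_le_degreeLT A (j + 1))).toEquiv
    rw [Module.natCard_eq_pow_finrank (K := ZMod 2) (V := annihilator A (j + 1)),
      Nat.card_zmod] at h
    exact h.symm
  have h2 : ∑ A : ι → Fin N → ZMod 2, 2 ^ nullity A (j + 1) =
      ∑ u : degreeLT (ZMod 2) (j + 1),
        Nat.card {A : ι → Fin N → ZMod 2 // u.1 ∈ annihilator A (j + 1)} := by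
    simp only [h1, Nat.card_eq_fintype_card, Fintype.card_subtype]
    exact Finset.sum_card_bipartiteAbove_eq_sum_card_bipartiteBelow _
  rw [h2, ← Finset.add_sum_erase _ _ (Finset.mem_univ 0), Finset.sum_congr rfl fun u hu =>
    card_mem_annihilator (ι := ι) hj (u := u.1) (by simpa using hu) u.2, Finset.sum_const,
    Finset.card_erase_of_mem (Finset.mem_univ _), Finset.card_univ, ← Nat.card_eq_fintype_card,
    natCard_degreeLT_s6, smul_eq_mul]
  congr 1
  simp

lemma card_nullity_eq_zero [DecidableEq ι] {j : ℕ} (hj : 2 * (j + 1) ≤ N) (hN : j + 1 < N) :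
    ((Finset.univ.filter fun A : ι → Fin N → ZMod 2 => nullity A (j + 2) = 0).card : ℤ) =
      (2 ^ N) ^ Fintype.card ι + (2 ^ (j + 2) - 2) * (2 ^ j) ^ Fintype.card ι -
        (2 ^ (j + 2) - 1) * (2 ^ (j + 1)) ^ Fintype.card ι := by
  have h1 (A : ι → Fin N → ZMod 2) : ((if nullity A (j + 2) = 0 then 1 else 0 : ℕ) : ℤ) =
      2 * 2 ^ nullity A (j + 1) - 2 ^ nullity A (j + 2) := by
    split_ifs with h
    · have h2 : nullity A (j + 1) = 0 :=
        Nat.le_zero.1 (h ▸ Submodule.finrank_mono (annihilator_le_succ A (j + 1)))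
      simp [h, h2]
    · rw [nullity_succ A hj hN h]
      push_cast
      ring
  have h2 := sum_two_pow_nullity (ι := ι) (show j < N by omega)
  have h3 := sum_two_pow_nullity (ι := ι) hN
  rw [Finset.card_filter, Nat.cast_sum, Finset.sum_congr rfl fun A _ => h1 A,
    Finset.sum_sub_distrib, ← Finset.mul_sum]
  zify [Nat.one_le_two_pow] at h2 h3
  rw [h2, h3]
  ring

end Count

section Pairs

variable {N : ℕ}

lemma annihilator_eq_single {ι : Type*} {A : ι → Fin N → ZMod 2} {γ : Fin N → ZMod 2}
    (h : ∀ a, A a = 0 ∨ A a = γ) (hγ : ∃ a, A a = γ) (j : ℕ) :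
    annihilator A j = annihilator (fun _ : Unit => γ) j := by
  ext u
  simp only [mem_annihilator]
  refine and_congr_right fun _ => ⟨fun H _ i hi => ?_, fun H a i hi => ?_⟩
  · obtain ⟨a, rfl⟩ := hγ
    exact H a i hi
  · rcases h a with h | h
    · simp [h, pairing_apply]
    · rw [h]
      exact H () i hi

lemma nullity_pair (γ : Fin N → ZMod 2) (j : ℕ) :
    nullity ![γ, 0] j = nullity (fun _ : Unit => γ) j ∧
    nullity ![0, γ] j = nullity (fun _ : Unit => γ) j ∧
    nullity ![γ, γ] j = nullity (fun _ : Unit => γ) j := by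
  refine ⟨?_, ?_, ?_⟩ <;> rw [nullity, annihilator_eq_single (γ := γ)] <;>
    simp [Fin.forall_fin_two, Fin.exists_fin_two, nullity]

/-- A single functional on polynomials of degree `< N` imposes `N + 1 - j` conditions. -/
lemma le_nullity_single (γ : Fin N → ZMod 2) {j : ℕ} :
    j ≤ nullity (fun _ : Unit => γ) j + (N + 1 - j) := by
  let M : Matrix (Fin (N + 1 - j)) (Fin j) (ZMod 2) :=
    Matrix.of fun i l => γ ⟨i + l, by omega⟩
  have h := nullity_add_rank (fun _ : Unit => γ) M fun u hu => by
    rw [funext_iff]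
    have h (i : Fin (N + 1 - j)) :
        M.mulVec (fun l => u.coeff l) i = pairing γ (X ^ (i : ℕ) * u) :=
      (pairing_X_pow_mul γ (by omega) hu).symm
    exact ⟨fun H i => (h i).trans (H () i (by omega)),
      fun H _ i hi => (h ⟨i, by omega⟩).symm.trans (H _)⟩
  have h2 := M.rank_le_height
  omega

lemma eq_pair_of_nullity {A : Fin 2 → Fin N → ZMod 2} (h : N ≤ nullity A N + 1) :
    ∃ γ, A = ![γ, 0] ∨ A = ![0, γ] ∨ A = ![γ, γ] := by
  have h1 := nullity_add_rank A (Matrix.of A) fun u hu => by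
    rw [funext_iff]
    have h (a : Fin 2) : (Matrix.of A).mulVec (fun l => u.coeff l) a = pairing (A a) u := by
      simp [pairing_apply, Matrix.mulVec, dotProduct]
    refine forall_congr' fun a => ?_
    rw [h]
    refine ⟨fun H => by simpa using H 0 (by omega), fun H i hi => ?_⟩
    obtain rfl : i = 0 := by omega
    simpa using H
  have h2 : ¬ LinearIndependent (ZMod 2) ![A 0, A 1] := by
    intro hli
    have h3 : LinearIndependent (ZMod 2) (Matrix.of A).row := by
      convert hli using 1
      ext a : 1
      fin_cases a <;> rfl
    have := h3.rank_matrix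
    rw [Fintype.card_fin] at this
    omega
  rw [LinearIndependent.pair_iff] at h2
  push Not at h2
  obtain ⟨c, d, hcd, hne⟩ := h2
  have hA : A = ![A 0, A 1] := by
    ext a : 1
    fin_cases a <;> rfl
  have key : ∀ x : ZMod 2, x = 0 ∨ x = 1 := by decide
  rcases key c with rfl | rfl <;> rcases key d with rfl | rfl
  · simp at hne
  · exact ⟨A 0, Or.inl (by rw [hA]; simpa using hcd)⟩
  · exact ⟨A 1, Or.inr (Or.inl (by rw [hA]; simpa using hcd))⟩
  · refine ⟨A 0, Or.inr (Or.inr ?_)⟩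
    have h3 : A 1 = A 0 := by
      funext i
      have h4 := congrFun hcd i
      simp only [one_smul, Pi.add_apply, Pi.zero_apply] at h4
      exact (CharTwo.add_eq_zero.1 h4).symm
    rw [hA, h3]
    simp

lemma nullity_eq_iff {s k : ℕ} (hs : 2 ≤ s) (hk : s < k)
    (A : Fin 2 → Fin (s + k - 1) → ZMod 2) :
    nullity A k = k - s ↔ (nullity A s = 0 ∧ nullity A (s + 1) ≠ 0) ∨
      (nullity A (s + 1) = 0 ∧ s + k - 1 ≤ nullity A (s + k - 1) + 1) := by
  have hc := fun j => nullity_convex A (j := j)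
  have hzero : nullity A s = 0 → nullity A (s + k - 1) < s + k - 1 := by
    intro h
    by_contra! h1
    rw [eq_zero_of_nullity h1, nullity_zero_family] at h
    omega
  have hmono : nullity A s ≤ nullity A (s + 1) := Submodule.finrank_mono (annihilator_le_succ A s)
  have hupper {a c : ℕ} (ha : a < k) (h : nullity A a + c * (k - a) < nullity A k) :
      nullity A k + (c + 1) * (s - 1) ≤ nullity A (s + k - 1) := by
    obtain ⟨t, rfl⟩ : ∃ t, k = a + t + 1 := ⟨k - a - 1, by omega⟩
    have h1 := last_slope_of_convex hc (a := a) (c := c) t (by omega)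
      (by rwa [show a + t + 1 - a = t + 1 by omega] at h)
    have h2 := add_mul_le_of_convex hc (add_le_succ_of_convex hc h1 1 (by omega)) (s - 1) (by omega)
    rwa [show a + t + 1 + (s - 1) = s + (a + t + 1) - 1 by omega] at h2
  have htop : nullity A s = 0 → nullity A k ≤ k - s := by
    intro h
    by_contra! h1
    have := hupper (a := s) (c := 1) hk (by omega)
    have := hzero h
    omega
  constructor
  · intro h
    by_cases h1 : nullity A (s + 1) = 0
    · refine Or.inr ⟨h1, ?_⟩
      have hk1 : s + 1 ≠ k := by
        rintro rfl
        omega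
      have := hupper (a := s + 1) (c := 1) (by omega) (by omega)
      omega
    · refine Or.inl ⟨?_, h1⟩
      by_contra h2
      obtain ⟨t, rfl⟩ : ∃ t, s = t + 1 := ⟨s - 1, by omega⟩
      have h3 := last_slope_of_convex hc (a := 0) (c := 0) t (by omega)
        (by simpa [nullity_zero, Nat.pos_iff_ne_zero] using h2)
      have h4 := add_mul_le_of_convex hc h3 (k - t) (by omega)
      rw [show 0 + t + (k - t) = k by omega] at h4
      omega
  · rintro (⟨h, h1⟩ | ⟨h, h1⟩)
    · refine le_antisymm (htop h) ?_
      have h2 := add_mul_le_of_convex hc (j := s) (c := 1) (by omega) (k - s) (by omega)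
      rw [Nat.add_sub_cancel' hk.le] at h2
      omega
    · refine le_antisymm (htop (by omega)) ?_
      obtain ⟨γ, hγ⟩ := eq_pair_of_nullity h1
      have h2 := le_nullity_single γ (j := k)
      have h3 : nullity A k = nullity (fun _ : Unit => γ) k := by
        rcases hγ with rfl | rfl | rfl
        exacts [(nullity_pair γ k).1, (nullity_pair γ k).2.1, (nullity_pair γ k).2.2]
      omega

lemma card_dependent_pairs {j : ℕ} (hj : j ≠ 0) :
    (Finset.univ.filter fun A : Fin 2 → Fin N → ZMod 2 =>
      nullity A j = 0 ∧ N ≤ nullity A N + 1).card =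
    3 * (Finset.univ.filter fun A : Unit → Fin N → ZMod 2 => nullity A j = 0).card := by
  classical
  set Z := Finset.univ.filter fun γ : Fin N → ZMod 2 => nullity (fun _ : Unit => γ) j = 0 with hZ
  have hne {γ : Fin N → ZMod 2} (hγ : γ ∈ Z) : γ ≠ 0 := by
    rintro rfl
    rw [hZ, Finset.mem_filter] at hγ
    exact hj ((nullity_zero_family (ι := Unit) (N := N) j).symm.trans hγ.2)
  have hunit : (Finset.univ.filter fun A : Unit → Fin N → ZMod 2 => nullity A j = 0).card =
      Z.card := by
    refine Finset.card_equiv (Equiv.funUnique Unit _) fun A => ?_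
    simp only [hZ, Finset.mem_filter, Finset.mem_univ, true_and]
    rfl
  have hunion : (Finset.univ.filter fun A : Fin 2 → Fin N → ZMod 2 =>
      nullity A j = 0 ∧ N ≤ nullity A N + 1) =
      Z.image (fun γ => ![γ, 0]) ∪ (Z.image (fun γ => ![0, γ]) ∪ Z.image (fun γ => ![γ, γ])) := by
    ext A
    simp only [hZ, Finset.mem_filter, Finset.mem_univ, true_and, Finset.mem_union,
      Finset.mem_image]
    constructor
    · rintro ⟨h, h1⟩
      obtain ⟨γ, rfl | rfl | rfl⟩ := eq_pair_of_nullity h1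
      · exact Or.inl ⟨γ, (nullity_pair γ j).1 ▸ h, rfl⟩
      · exact Or.inr (Or.inl ⟨γ, (nullity_pair γ j).2.1 ▸ h, rfl⟩)
      · exact Or.inr (Or.inr ⟨γ, (nullity_pair γ j).2.2 ▸ h, rfl⟩)
    · rintro (⟨γ, h, rfl⟩ | ⟨γ, h, rfl⟩ | ⟨γ, h, rfl⟩) <;>
      · have h1 := le_nullity_single γ (j := N)
        simp only [nullity_pair]
        omega
  rw [hunit, hunion, Finset.card_union_of_disjoint, Finset.card_union_of_disjoint,
    Finset.card_image_of_injective, Finset.card_image_of_injective, Finset.card_image_of_injective]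
  · ring
  · exact fun γ γ' h => congrFun h 0
  · exact fun γ γ' h => congrFun h 1
  · exact fun γ γ' h => congrFun h 0
  · simp only [Finset.disjoint_left, Finset.mem_image]
    rintro _ ⟨γ, hγ, rfl⟩ ⟨γ', hγ', h⟩
    exact hne hγ' (congrFun h 0)
  · simp only [Finset.disjoint_left, Finset.mem_image, Finset.mem_union]
    rintro _ ⟨γ, hγ, rfl⟩ (⟨γ', hγ', h⟩ | ⟨γ', hγ', h⟩)
    · exact hne hγ (congrFun h 0).symm
    · exact hne hγ' (congrFun h 1)

lemma nullity_add_rank_fromRows {s k : ℕ} (hk : s < k)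
    (p : (Fin (s + k - 1) → ZMod 2) × (Fin (s + k - 1) → ZMod 2)) :
    nullity ![p.1, p.2] k + (Matrix.fromRows (hankel s k p.1) (hankel s k p.2)).rank = k := by
  refine nullity_add_rank _ _ fun u hu => ?_
  have h (α : Fin (s + k - 1) → ZMod 2) (i : Fin s) :
      (hankel s k α).mulVec (fun l => u.coeff l) i = pairing α (X ^ (i : ℕ) * u) :=
    (pairing_X_pow_mul α (by omega) hu).symm
  rw [Matrix.fromRows_mulVec, funext_iff, Sum.forall, Fin.forall_fin_two]
  simp only [Sum.elim_inl, Sum.elim_inr, h, Pi.zero_apply]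
  exact and_congr ⟨fun H i => H i (by omega), fun H i hi => H ⟨i, by omega⟩⟩
    ⟨fun H i => H i (by omega), fun H i hi => H ⟨i, by omega⟩⟩

lemma Gamma_eq_card {s k : ℕ} (hk : s < k) :
    Gamma s s k s = (Finset.univ.filter fun A : Fin 2 → Fin (s + k - 1) → ZMod 2 =>
      nullity A k = k - s).card := by
  classical
  rw [Gamma, Nat.card_eq_fintype_card, Fintype.card_subtype]
  refine Finset.card_equiv (finTwoArrowEquiv _).symm fun p => ?_
  have h := nullity_add_rank_fromRows hk p
  simp only [Finset.mem_filter, Finset.mem_univ, true_and, finTwoArrowEquiv_symm_apply]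
  omega

end Pairs

theorem Gamma_s_of_square_case (s k : ℕ) (hs : 2 ≤ s) (hk : s < k) :
    (Gamma s s k s : ℤ) = 3 * 2 ^ (k + s - 1) + 21 * 2 ^ (3 * s - 4) - 27 * 2 ^ (2 * s - 3) := by
  classical
  have hsplit : Gamma s s k s +
      (Finset.univ.filter fun A : Fin 2 → Fin (s + k - 1) → ZMod 2 => nullity A (s + 1) = 0).card =
      (Finset.univ.filter fun A : Fin 2 → Fin (s + k - 1) → ZMod 2 => nullity A s = 0).card +
      3 * (Finset.univ.filter fun A : Unit → Fin (s + k - 1) → ZMod 2 =>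
        nullity A (s + 1) = 0).card := by
    rw [← card_dependent_pairs (show s + 1 ≠ 0 by omega), Gamma_eq_card hk]
    simp only [Finset.card_filter, ← Finset.sum_add_distrib]
    refine Finset.sum_congr rfl fun A _ => ?_
    have h1 := nullity_eq_iff hs hk A
    have h2 : nullity A s ≤ nullity A (s + 1) :=
      Submodule.finrank_mono (annihilator_le_succ A s)
    split_ifs <;> omega
  obtain ⟨t, rfl⟩ : ∃ t, s = t + 2 := ⟨s - 2, by omega⟩
  have h1 := card_nullity_eq_zero (ι := Fin 2) (N := t + 2 + k - 1) (j := t) (by omega) (by omega)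
  have h2 := card_nullity_eq_zero (ι := Fin 2) (N := t + 2 + k - 1) (j := t + 1)
    (by omega) (by omega)
  have h3 := card_nullity_eq_zero (ι := Unit) (N := t + 2 + k - 1) (j := t + 1)
    (by omega) (by omega)
  replace hsplit := congrArg (Nat.cast : ℕ → ℤ) hsplit
  rw [Nat.cast_add, Nat.cast_add, Nat.cast_mul, Nat.cast_ofNat,
    show t + 2 + 1 = t + 1 + 2 by omega, h1, h2, h3] at hsplit
  rw [eq_sub_of_add_eq hsplit, show k + (t + 2) - 1 = t + 2 + k - 1 by omega,
    show 3 * (t + 2) - 4 = 3 * t + 2 by omega, show 2 * (t + 2) - 3 = 2 * t + 1 by omega]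
  simp only [Fintype.card_fin, Fintype.card_unit]
  ring
end

section
/- Let s ≥ 2, m ≥ 1 and k > s. Then Γ_s^{[s,s+m]×k} = 2^{k+s−1} + 21·2^{3s−4} − 11·2^{2s−3}; in particular this value is independent of m ≥ 1. -/
open Matrix

open Polynomial Module

section Annihilator

variable {K : Type*} [Field K]

theorem mem_degreeLT_iff_natDegree_lt {n : ℕ} {p : K[X]} (hp : p ≠ 0) :
    p ∈ degreeLT K n ↔ p.natDegree < n := by
  rw [mem_degreeLT, natDegree_lt_iff_degree_lt hp]

theorem mul_mem_degreeLT {a b n : ℕ} {p q : K[X]} (hp : p ∈ degreeLT K a)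
    (hq : q ∈ degreeLT K b) (h : a + b ≤ n + 1) : p * q ∈ degreeLT K n := by
  by_cases hp0 : p = 0
  · simp [hp0]
  by_cases hq0 : q = 0
  · simp [hq0]
  rw [mem_degreeLT_iff_natDegree_lt hp0] at hp
  rw [mem_degreeLT_iff_natDegree_lt hq0] at hq
  rw [mem_degreeLT_iff_natDegree_lt (mul_ne_zero hp0 hq0), natDegree_mul hp0 hq0]
  omega

theorem finrank_degreeLT_s7 (n : ℕ) : finrank K (degreeLT K n) = n := by
  rw [(degreeLTEquiv K n).finrank_eq, finrank_fin_fun]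

instance finiteDimensional_degreeLT (n : ℕ) : FiniteDimensional K (degreeLT K n) :=
  (degreeLTEquiv K n).symm.finiteDimensional

/-- A Bézout identity with control of the degrees of both cofactors. -/
theorem IsCoprime.exists_mul_add_mul_eq_of_natDegree {g w h : K[X]} (hc : IsCoprime g w)
    (hg : g ≠ 0) (hw : w ≠ 0) {p N : ℕ} (hp : g.natDegree ≤ p) (hN : p + w.natDegree ≤ N)
    (hh : h ∈ degreeLT K N) :
    ∃ A ∈ degreeLT K (N - p), ∃ B ∈ degreeLT K (N - w.natDegree), A * g + B * w = h := by
  obtain ⟨a, b, hab⟩ := hc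
  have key : (h * a % w) * g + (g * (h * a / w) + h * b) * w = h := by
    have h1 := EuclideanDomain.div_add_mod (h * a) w
    calc _ = (w * (h * a / w) + h * a % w) * g + h * b * w := by ring
      _ = h * (a * g + b * w) := by rw [h1]; ring
      _ = h := by rw [hab, mul_one]
  have hA : h * a % w ∈ degreeLT K w.natDegree := by
    rw [mem_degreeLT, ← degree_eq_natDegree hw]
    exact degree_mod_lt _ hw
  refine ⟨_, degreeLT_mono (by omega) hA, _, ?_, key⟩
  by_cases hB : g * (h * a / w) + h * b = 0
  · rw [hB]; exact zero_mem _
  have hBw : (g * (h * a / w) + h * b) * w ∈ degreeLT K N := by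
    rw [← eq_sub_iff_add_eq'] at key
    rw [key]
    refine sub_mem hh (mul_mem_degreeLT (b := p + 1) hA ?_ (by omega))
    rw [mem_degreeLT_iff_natDegree_lt hg]
    omega
  rw [mem_degreeLT_iff_natDegree_lt (mul_ne_zero hB hw), natDegree_mul hB hw] at hBw
  rw [mem_degreeLT_iff_natDegree_lt hB]
  omega

/-- The kernel of the `r × c` Hankel matrix `(L (X ^ (i + j)))`, whose elements are viewed as
polynomials of degree less than `c`. -/
def hankelKer (L : K[X] →ₗ[K] K) (r c : ℕ) : Submodule K K[X] where
  carrier := {v | v ∈ degreeLT K c ∧ ∀ A ∈ degreeLT K r, L (A * v) = 0}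
  add_mem' := fun ⟨h1, h2⟩ ⟨h3, h4⟩ =>
    ⟨add_mem h1 h3, fun A hA => by rw [mul_add, map_add, h2 A hA, h4 A hA, add_zero]⟩
  zero_mem' := ⟨zero_mem _, fun A _ => by simp⟩
  smul_mem' := fun t v ⟨h1, h2⟩ =>
    ⟨Submodule.smul_mem _ t h1, fun A hA => by rw [mul_smul_comm, map_smul, h2 A hA, smul_zero]⟩

theorem mem_hankelKer {L : K[X] →ₗ[K] K} {r c : ℕ} {v : K[X]} :
    v ∈ hankelKer L r c ↔ v ∈ degreeLT K c ∧ ∀ A ∈ degreeLT K r, L (A * v) = 0 :=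
  Iff.rfl

theorem hankelKer_le_degreeLT (L : K[X] →ₗ[K] K) (r c : ℕ) :
    hankelKer L r c ≤ degreeLT K c := fun _ hv => hv.1

instance finiteDimensional_hankelKer (L : K[X] →ₗ[K] K) (r c : ℕ) :
    FiniteDimensional K (hankelKer L r c) :=
  Submodule.finiteDimensional_of_le (hankelKer_le_degreeLT L r c)

theorem mul_mem_hankelKer {L : K[X] →ₗ[K] K} {r c a r' c' : ℕ} {g h : K[X]}
    (hg : g ∈ hankelKer L r c) (hh : h ∈ degreeLT K a) (hc : c + a ≤ c' + 1)
    (hr : r' + a ≤ r + 1) : g * h ∈ hankelKer L r' c' := by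
  refine ⟨mul_mem_degreeLT hg.1 hh hc, fun A hA => ?_⟩
  rw [mul_comm g h, ← mul_assoc]
  exact hg.2 _ (mul_mem_degreeLT hA hh hr)

/-- The gcd of two elements of Hankel kernels lies in the Hankel kernel of the appropriate shape;
the shape `c` accounts for common zeros at infinity. -/
theorem exists_gcd_mem_hankelKer {g w : K[X]} (hg : g ≠ 0) (hw : w ≠ 0) {c₁ c₂ : ℕ}
    (hgc : g ∈ degreeLT K c₁) (hwc : w ∈ degreeLT K c₂) :
    ∃ (u : K[X]) (c : ℕ), u ≠ 0 ∧ u ∣ g ∧ u ∣ w ∧ c + g.natDegree ≤ c₁ + u.natDegree ∧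
      c + w.natDegree ≤ c₂ + u.natDegree ∧
      ∀ (L : K[X] →ₗ[K] K) (r₁ r₂ : ℕ), g ∈ hankelKer L r₁ c₁ → w ∈ hankelKer L r₂ c₂ →
        r₁ + c₁ = r₂ + c₂ → c₂ ≤ r₁ + 1 → u ∈ hankelKer L (r₁ + c₁ - c) c := by
  classical
  obtain ⟨g', hg'⟩ := EuclideanDomain.gcd_dvd_left g w
  obtain ⟨w', hw'⟩ := EuclideanDomain.gcd_dvd_right g w
  have hab := EuclideanDomain.gcd_eq_gcd_ab g w
  generalize EuclideanDomain.gcdA g w = a at hab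
  generalize EuclideanDomain.gcdB g w = b at hab
  generalize EuclideanDomain.gcd g w = u at hg' hw' hab
  have hu : u ≠ 0 := by rintro rfl; simp at hg'; exact hg hg'
  have hg'0 : g' ≠ 0 := by rintro rfl; simp at hg'; exact hg hg'
  have hw'0 : w' ≠ 0 := by rintro rfl; simp at hw'; exact hw hw'
  have hcop : IsCoprime g' w' := by
    refine ⟨a, b, mul_left_cancel₀ hu ?_⟩
    calc u * (a * g' + b * w') = (u * g') * a + (u * w') * b := by ring
      _ = u * 1 := by rw [← hg', ← hw', ← hab, mul_one]
  have hdg : g.natDegree = u.natDegree + g'.natDegree := by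
    conv_lhs => rw [hg', natDegree_mul hu hg'0]
  have hdw : w.natDegree = u.natDegree + w'.natDegree := by
    conv_lhs => rw [hw', natDegree_mul hu hw'0]
  rw [mem_degreeLT_iff_natDegree_lt hg] at hgc
  rw [mem_degreeLT_iff_natDegree_lt hw] at hwc
  refine ⟨u, min (c₁ - g'.natDegree) (c₂ - w'.natDegree), hu, ⟨g', hg'⟩, ⟨w', hw'⟩,
    by omega, by omega, fun L r₁ r₂ hgL hwL hr hc => ?_⟩
  generalize hcdef : min (c₁ - g'.natDegree) (c₂ - w'.natDegree) = c
  refine ⟨by rw [mem_degreeLT_iff_natDegree_lt hu]; omega, fun h hh => ?_⟩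
  obtain ⟨A, hA, B, hB, hsum⟩ : ∃ A ∈ degreeLT K r₁, ∃ B ∈ degreeLT K r₂,
      A * g' + B * w' = h := by
    rcases le_total (c₁ - g'.natDegree) (c₂ - w'.natDegree) with hle | hle
    · obtain ⟨B, hB, A, hA, hsum⟩ := hcop.symm.exists_mul_add_mul_eq_of_natDegree hw'0 hg'0
        (p := c₂ - c) (by omega) (by omega) hh
      exact ⟨A, degreeLT_mono (by omega) hA, B, degreeLT_mono (by omega) hB,
        by rw [add_comm, hsum]⟩
    · obtain ⟨A, hA, B, hB, hsum⟩ := hcop.exists_mul_add_mul_eq_of_natDegree hg'0 hw'0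
        (p := c₁ - c) (by omega) (by omega) hh
      exact ⟨A, degreeLT_mono (by omega) hA, B, degreeLT_mono (by omega) hB, hsum⟩
  have : h * u = A * g + B * w := by
    calc h * u = A * (u * g') + B * (u * w') := by rw [← hsum]; ring
      _ = A * g + B * w := by rw [← hg', ← hw']
  rw [this, map_add, hgL.2 A hA, hwL.2 B hB, add_zero]

/-- If a pair of Hankel kernels is nonzero in a sufficiently small shape, then the pair kernels are
principal, generated by a common element `g` which is homogeneous of degree `e - 1`. -/
theorem exists_generator_hankelKer {L₁ L₂ : K[X] →ₗ[K] K} {M M₁ M₂ c₀ : ℕ} (h₁ : M ≤ M₁)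
    (h₂ : M ≤ M₂) (hc₀ : c₀ ≤ M)
    (hne : hankelKer L₁ (M₁ - c₀) c₀ ⊓ hankelKer L₂ (M₂ - c₀) c₀ ≠ ⊥) :
    ∃ (e : ℕ) (g : K[X]), 1 ≤ e ∧ e ≤ c₀ ∧ g ≠ 0 ∧ g ∈ hankelKer L₁ (M₁ - e) e ∧
      g ∈ hankelKer L₂ (M₂ - e) e ∧ ∀ c, e + c ≤ M + 1 →
        hankelKer L₁ (M₁ - c) c ⊓ hankelKer L₂ (M₂ - c) c =
          (degreeLT K (c + 1 - e)).map (LinearMap.mulLeft K g) := by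
  classical
  have hex : ∃ e, hankelKer L₁ (M₁ - e) e ⊓ hankelKer L₂ (M₂ - e) e ≠ ⊥ := ⟨c₀, hne⟩
  obtain ⟨e, he⟩ : ∃ e, e = Nat.find hex := ⟨_, rfl⟩
  have hspec := Nat.find_spec hex
  have hmin : ∀ c, hankelKer L₁ (M₁ - c) c ⊓ hankelKer L₂ (M₂ - c) c ≠ ⊥ → e ≤ c :=
    fun c hc => he ▸ Nat.find_min' hex hc
  rw [← he] at hspec
  obtain ⟨g, ⟨hg1, hg2⟩, hg⟩ := (Submodule.ne_bot_iff _).1 hspec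
  have hec := hmin _ hne
  have hge : g.natDegree < e := (mem_degreeLT_iff_natDegree_lt hg).1 hg1.1
  refine ⟨e, g, by omega, hec, hg, hg1, hg2, fun c hc => le_antisymm ?_ ?_⟩
  · rintro w ⟨hw1, hw2⟩
    by_cases hw : w = 0
    · rw [hw]; exact zero_mem _
    obtain ⟨u, d, hu, hug, huw, hdg, hdw, hL⟩ :=
      exists_gcd_mem_hankelKer hg hw hg1.1 hw1.1
    have hu1 := hL L₁ _ _ hg1 hw1 (by omega) (by omega)
    have hu2 := hL L₂ _ _ hg2 hw2 (by omega) (by omega)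
    rw [show M₁ - e + e = M₁ by omega] at hu1
    rw [show M₂ - e + e = M₂ by omega] at hu2
    have hed := hmin d ((Submodule.ne_bot_iff _).2 ⟨u, ⟨hu1, hu2⟩, hu⟩)
    have hgu : g ∣ u := by
      obtain ⟨t, ht⟩ := hug
      have ht0 : t ≠ 0 := by rintro rfl; simp at ht; exact hg ht
      have hdeg : g.natDegree = u.natDegree + t.natDegree := by
        conv_lhs => rw [ht, natDegree_mul hu ht0]
      have htu : IsUnit t := by
        rw [isUnit_iff_degree_eq_zero, degree_eq_natDegree ht0]
        have : t.natDegree = 0 := by omega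
        simp [this]
      rw [ht]
      exact (htu.mul_right_dvd).2 dvd_rfl
    obtain ⟨h, hh⟩ := hgu.trans huw
    refine ⟨h, ?_, hh.symm⟩
    have hh0 : h ≠ 0 := by rintro rfl; simp at hh; exact hw hh
    have hdeg : w.natDegree = g.natDegree + h.natDegree := by
      conv_lhs => rw [hh, natDegree_mul hg hh0]
    have := natDegree_le_of_dvd hug hg
    have := (mem_degreeLT_iff_natDegree_lt hw).1 hw1.1
    show h ∈ degreeLT K _
    rw [mem_degreeLT_iff_natDegree_lt hh0]
    omega
  · rintro _ ⟨h, hh, rfl⟩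
    have hh' : h ∈ degreeLT K (c + 1 - e) := hh
    rcases Nat.lt_or_ge c e with hce | hce
    · rw [show c + 1 - e = 0 by omega, mem_degreeLT] at hh'
      have h0 : h = 0 := by
        by_contra h0
        rw [degree_eq_natDegree h0] at hh'
        exact absurd (Nat.cast_lt.1 hh') (by omega)
      rw [h0, map_zero]; exact zero_mem _
    · exact ⟨mul_mem_hankelKer hg1 hh' (by omega) (by omega),
        mul_mem_hankelKer hg2 hh' (by omega) (by omega)⟩

theorem finrank_map_mulLeft_degreeLT {g : K[X]} (hg : g ≠ 0) (n : ℕ) :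
    finrank K ((degreeLT K n).map (LinearMap.mulLeft K g)) = n := by
  rw [← (Submodule.equivMapOfInjective (LinearMap.mulLeft K g)
    (fun a b h => mul_left_cancel₀ hg h) (degreeLT K n)).finrank_eq, finrank_degreeLT_s7]

end Annihilator

section HankelRank

variable {K : Type*} [Field K]

theorem hankelKer_dichotomy (L₁ L₂ : K[X] →ₗ[K] K) {M M₁ M₂ c₀ : ℕ} (h₁ : M ≤ M₁) (h₂ : M ≤ M₂)
    (hc₀ : 2 * c₀ ≤ M + 1) (hc₀' : 1 ≤ M) :
    (∀ c ≤ c₀, hankelKer L₁ (M₁ - c) c ⊓ hankelKer L₂ (M₂ - c) c = ⊥) ∨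
    ∃ e, 1 ≤ e ∧ e ≤ c₀ ∧ ∀ c, e + c ≤ M + 1 →
      finrank K ↥(hankelKer L₁ (M₁ - c) c ⊓ hankelKer L₂ (M₂ - c) c) = c + 1 - e := by
  by_cases h : ∀ c ≤ c₀, hankelKer L₁ (M₁ - c) c ⊓ hankelKer L₂ (M₂ - c) c = ⊥
  · exact Or.inl h
  push Not at h
  obtain ⟨c, hc, hne⟩ := h
  obtain ⟨e, g, he1, hec, hg, -, -, hQ⟩ := exists_generator_hankelKer h₁ h₂ (by omega) hne
  refine Or.inr ⟨e, he1, by omega, fun c hc => ?_⟩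
  rw [hQ c hc, finrank_map_mulLeft_degreeLT hg]

theorem mem_hankelKer_iff_X_pow {L : K[X] →ₗ[K] K} {r c : ℕ} {v : K[X]} :
    v ∈ hankelKer L r c ↔ v ∈ degreeLT K c ∧ ∀ i : Fin r, L (X ^ (i : ℕ) * v) = 0 := by
  refine and_congr_right fun _ => ⟨fun h i => h _ ?_, fun h A hA => ?_⟩
  · rw [mem_degreeLT, degree_X_pow]
    exact_mod_cast i.2
  · have : degreeLT K r ≤ LinearMap.ker (L ∘ₗ LinearMap.mulRight K v) := by
      classical
      rw [degreeLT_eq_span_X_pow, Submodule.span_le]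
      intro p hp
      simp only [Finset.coe_image, Finset.coe_range, Set.mem_image, Set.mem_Iio] at hp
      obtain ⟨i, hi, rfl⟩ := hp
      exact h ⟨i, hi⟩
    exact this hA

theorem map_X_pow_mul_degreeLTEquiv_symm (L : K[X] →ₗ[K] K) (i : ℕ) {c : ℕ} (v : Fin c → K) :
    L (X ^ i * ((degreeLTEquiv K c).symm v : K[X])) = ∑ j : Fin c, L (X ^ (i + (j : ℕ))) * v j := by
  have : ((degreeLTEquiv K c).symm v : K[X]) = ∑ j : Fin c, v j • X ^ (j : ℕ) := by
    simp only [smul_X_eq_monomial]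
    rfl
  rw [this, Finset.mul_sum, map_sum]
  refine Finset.sum_congr rfl fun j _ => ?_
  rw [mul_smul_comm, ← pow_add, map_smul, smul_eq_mul, mul_comm]

/-- Rank-nullity for a matrix whose kernel is described by polynomials. -/
theorem finrank_add_rank_of_mulVec_eq_zero_iff {ι : Type*} [Fintype ι] {c : ℕ}
    {A : Matrix ι (Fin c) K} {P : Submodule K K[X]} (hP : P ≤ degreeLT K c)
    (h : ∀ v, A *ᵥ v = 0 ↔ ((degreeLTEquiv K c).symm v : K[X]) ∈ P) :
    finrank K P + A.rank = c := by
  have hmap : P = (LinearMap.ker A.mulVecLin).map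
      ((degreeLT K c).subtype ∘ₗ (degreeLTEquiv K c).symm.toLinearMap) := by
    ext p
    constructor
    · intro hp
      refine ⟨degreeLTEquiv K c ⟨p, hP hp⟩, ?_, by simp⟩
      show A *ᵥ _ = 0
      rw [h]
      simpa using hp
    · rintro ⟨v, hv, rfl⟩
      exact (h v).1 hv
  have hinj : Function.Injective
      ((degreeLT K c).subtype ∘ₗ (degreeLTEquiv K c).symm.toLinearMap) := by
    exact Subtype.val_injective.comp (degreeLTEquiv K c).symm.injective
  rw [hmap, ← (Submodule.equivMapOfInjective _ hinj _).finrank_eq, add_comm, Matrix.rank,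
    LinearMap.finrank_range_add_finrank_ker, finrank_fin_fun]

theorem finrank_hankelKer_add_comm (L : K[X] →ₗ[K] K) (r c : ℕ) :
    finrank K (hankelKer L r c) + r = finrank K (hankelKer L c r) + c := by
  have key : ∀ r c, finrank K (hankelKer L r c) +
      (Matrix.of fun (i : Fin r) (j : Fin c) => L (X ^ ((i : ℕ) + (j : ℕ)))).rank = c := by
    intro r c
    refine finrank_add_rank_of_mulVec_eq_zero_iff (hankelKer_le_degreeLT L r c) fun v => ?_
    rw [mem_hankelKer_iff_X_pow, and_iff_right ((degreeLTEquiv K c).symm v).2, funext_iff]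
    simp only [map_X_pow_mul_degreeLTEquiv_symm]
    rfl
  have h1 := key r c
  have h2 := key c r
  rw [← Matrix.rank_transpose] at h2
  have : (Matrix.of fun (i : Fin c) (j : Fin r) => L (X ^ ((i : ℕ) + (j : ℕ)))).transpose =
      Matrix.of fun (i : Fin r) (j : Fin c) => L (X ^ ((i : ℕ) + (j : ℕ))) := by
    ext i j
    simp [add_comm]
  rw [this] at h2
  omega

theorem ne_bot_of_finrank_pos {P : Submodule K K[X]} (h : 0 < finrank K P) : P ≠ ⊥ := by
  rintro rfl
  simp at h

/-- If the stacked `(a + b) × k` Hankel matrix with `a < k`, `a < b` has rank at most `a` but its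
columns satisfy no relation of length `a + 1`, then the second block vanishes. -/
theorem map_eq_zero_of_finrank_hankelKer {L₁ L₂ : K[X] →ₗ[K] K} {s m k : ℕ} (hm : 1 ≤ m)
    (hk : s < k)
    (hfin : finrank K ↥(hankelKer L₁ s k ⊓ hankelKer L₂ (s + m) k) = k - s)
    (hbot : hankelKer L₁ (k - 1) (s + 1) ⊓ hankelKer L₂ (k + m - 1) (s + 1) = ⊥) :
    ∀ A ∈ degreeLT K (s + m + k - 1), L₂ A = 0 := by
  have hsym := finrank_hankelKer_add_comm L₂ (s + m) k
  have hle := Submodule.finrank_mono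
    (inf_le_right : hankelKer L₁ s k ⊓ hankelKer L₂ (s + m) k ≤ _)
  rw [hfin] at hle
  obtain ⟨e, g, he1, hes, hg, hge, -, hQ⟩ := exists_generator_hankelKer (L₁ := L₂) (L₂ := L₂)
    (M := s + m + k) (M₁ := s + m + k) (M₂ := s + m + k) (c₀ := s + m) le_rfl le_rfl (by omega)
    (by
      rw [inf_idem, show s + m + k - (s + m) = k by omega]
      exact ne_bot_of_finrank_pos (by omega))
  simp only [inf_idem] at hQ
  have hQk := hQ k (by omega)
  rw [show s + m + k - k = s + m by omega] at hQk
  have hek : e ≤ s + 1 := by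
    rw [hQk, finrank_map_mulLeft_degreeLT hg] at hle
    omega
  rcases Nat.lt_or_ge 1 e with he2 | he2
  · exfalso
    set δ : K[X] →ₗ[K] K := L₁ ∘ₗ LinearMap.mulLeft K g with hδ
    have hδA : ∀ A h : K[X], δ (A * h) = L₁ (A * (g * h)) := fun A h => by
      simp only [hδ, LinearMap.comp_apply, LinearMap.mulLeft_apply]
      congr 1; ring
    have hinf : hankelKer L₁ s k ⊓ hankelKer L₂ (s + m) k =
        (hankelKer δ s (k + 1 - e)).map (LinearMap.mulLeft K g) := by
      rw [hQk]
      ext w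
      constructor
      · rintro ⟨hw, h, hh, rfl⟩
        exact ⟨h, ⟨hh, fun A hA => by rw [hδA]; exact hw.2 A hA⟩, rfl⟩
      · rintro ⟨h, hh, rfl⟩
        exact ⟨⟨mul_mem_degreeLT hge.1 hh.1 (by omega),
          fun A hA => by rw [LinearMap.mulLeft_apply, ← hδA]; exact hh.2 A hA⟩, h, hh.1, rfl⟩
    have hfδ : finrank K (hankelKer δ s (k + 1 - e)) = k - s := by
      rw [← hfin, hinf]
      exact (Submodule.equivMapOfInjective (LinearMap.mulLeft K g)
        (fun a b h => mul_left_cancel₀ hg h) _).finrank_eq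
    have hsymδ := finrank_hankelKer_add_comm δ s (k + 1 - e)
    obtain ⟨e', g', he1', hes', hg', hge', -, hQ'⟩ :=
      exists_generator_hankelKer (L₁ := δ) (L₂ := δ) (M := s + (k + 1 - e))
        (M₁ := s + (k + 1 - e)) (M₂ := s + (k + 1 - e)) (c₀ := s) le_rfl le_rfl (by omega)
        (by
          rw [inf_idem, show s + (k + 1 - e) - s = k + 1 - e by omega]
          exact ne_bot_of_finrank_pos (by omega))
    have hf := hQ' (k + 1 - e) (by omega)
    rw [inf_idem, show s + (k + 1 - e) - (k + 1 - e) = s by omega] at hf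
    rw [hf, finrank_map_mulLeft_degreeLT hg'] at hfδ
    have hmem : g * g' ∈ hankelKer L₁ (k - 1) (s + 1) ⊓ hankelKer L₂ (k + m - 1) (s + 1) := by
      refine ⟨⟨mul_mem_degreeLT hge.1 hge'.1 (by omega), fun A hA => ?_⟩,
        mul_mem_hankelKer hge hge'.1 (by omega) (by omega)⟩
      rw [← hδA]
      exact hge'.2 A (degreeLT_mono (by omega) hA)
    rw [hbot, Submodule.mem_bot] at hmem
    exact mul_ne_zero hg hg' hmem
  · obtain rfl : e = 1 := by omega
    intro A hA
    have hdeg := (mem_degreeLT_iff_natDegree_lt hg).1 hge.1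
    obtain ⟨t, ht⟩ : ∃ t, C t = g := ⟨_, (eq_C_of_natDegree_eq_zero (by omega)).symm⟩
    have ht0 : t ≠ 0 := by rintro rfl; simp at ht; exact hg ht.symm
    have := hge.2 A hA
    rw [← ht, mul_comm, ← smul_eq_C_mul, map_smul, smul_eq_mul] at this
    exact (mul_eq_zero.1 this).resolve_left ht0

theorem hankelKer_zero (r c : ℕ) : hankelKer (0 : K[X] →ₗ[K] K) r c = degreeLT K c :=
  le_antisymm (hankelKer_le_degreeLT _ _ _) fun _ hv => ⟨hv, fun _ _ => rfl⟩

/-- If the columns of a Hankel matrix with `s < k` satisfy no relation of length `s + 1`, then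
the `s × k` matrix has full rank. -/
theorem finrank_hankelKer_of_eq_bot {L : K[X] →ₗ[K] K} {s k : ℕ} (hk : s < k)
    (hbot : hankelKer L (k - 1) (s + 1) = ⊥) : finrank K (hankelKer L s k) = k - s := by
  have hle : hankelKer L k s ≤ hankelKer L (k - 1) (s + 1) := fun v hv =>
    ⟨degreeLT_mono (by omega) hv.1, fun A hA => hv.2 A (degreeLT_mono (by omega) hA)⟩
  rw [hbot, le_bot_iff] at hle
  have := finrank_hankelKer_add_comm L s k
  rw [hle, finrank_bot] at this
  omega

/-- The linear functional on polynomials whose moments are the entries of `α`. -/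
noncomputable def momentFunctional {n : ℕ} (α : Fin n → K) : K[X] →ₗ[K] K :=
  ∑ i, α i • lcoeff K i

theorem momentFunctional_apply {n : ℕ} (α : Fin n → K) (p : K[X]) :
    momentFunctional α p = ∑ i : Fin n, p.coeff i * α i := by
  simp [momentFunctional, mul_comm]

theorem momentFunctional_X_pow {n : ℕ} (α : Fin n → K) (i : Fin n) :
    momentFunctional α (X ^ (i : ℕ)) = α i := by
  simp [momentFunctional_apply, coeff_X_pow, Fin.val_inj]

theorem momentFunctional_zero (n : ℕ) : momentFunctional (0 : Fin n → K) = 0 := by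
  simp [momentFunctional]

theorem eq_zero_of_momentFunctional {n : ℕ} {α : Fin n → K}
    (h : ∀ A ∈ degreeLT K n, momentFunctional α A = 0) : α = 0 := by
  funext i
  rw [← momentFunctional_X_pow α i, h, Pi.zero_apply]
  rw [mem_degreeLT, degree_X_pow]
  exact_mod_cast i.2

theorem finrank_ker_moment {n r c : ℕ} (hn : n + 1 = r + c) {v : K[X]} (hv : v ≠ 0)
    (hvc : v ∈ degreeLT K c) :
    ∃ S : Submodule K (Fin n → K), finrank K S = c - 1 ∧
      ∀ α, α ∈ S ↔ v ∈ hankelKer (momentFunctional α) r c := by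
  have hc := (mem_degreeLT_iff_natDegree_lt hv).1 hvc
  let B : Matrix (Fin r) (Fin n) K := Matrix.of fun i l => (X ^ (i : ℕ) * v).coeff l
  have hB : LinearIndependent K B.row := by
    rw [Fintype.linearIndependent_iff]
    intro t ht
    have hmul : ((degreeLTEquiv K r).symm t : K[X]) * v = 0 := by
      ext l
      rw [coeff_zero]
      by_cases hl : l < n
      · have hsum : ((degreeLTEquiv K r).symm t : K[X]) = ∑ j : Fin r, t j • X ^ (j : ℕ) := by
          simp only [smul_X_eq_monomial]
          rfl
        rw [hsum, Finset.sum_mul, finsetSum_coeff]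
        have := congrFun ht ⟨l, hl⟩
        simp only [Finset.sum_apply, Pi.smul_apply, Pi.zero_apply] at this
        rw [← this]
        refine Finset.sum_congr rfl fun j _ => ?_
        rw [smul_mul_assoc, coeff_smul]
        rfl
      · have hdeg := mul_mem_degreeLT (n := n) ((degreeLTEquiv K r).symm t).2 hvc (by omega)
        exact coeff_eq_zero_of_degree_lt
          ((mem_degreeLT.1 hdeg).trans_le (by exact_mod_cast not_lt.1 hl))
    have h0 : (degreeLTEquiv K r).symm t = 0 :=
      Subtype.ext ((mul_eq_zero.1 hmul).resolve_right hv)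
    rw [LinearEquiv.map_eq_zero_iff] at h0
    exact fun i => congrFun h0 i
  refine ⟨LinearMap.ker B.mulVecLin, ?_, fun α => ?_⟩
  · have h1 := LinearMap.finrank_range_add_finrank_ker B.mulVecLin
    have h2 := hB.rank_matrix
    rw [Matrix.rank, Fintype.card_fin] at h2
    rw [h2, finrank_fin_fun] at h1
    omega
  · rw [mem_hankelKer_iff_X_pow, and_iff_right hvc, LinearMap.mem_ker, funext_iff]
    simp only [momentFunctional_apply]
    rfl

theorem finrank_add_rank_fromRows_hankel {a b k : ℕ} (α : Fin (a + k - 1) → ZMod 2)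
    (β : Fin (b + k - 1) → ZMod 2) :
    finrank (ZMod 2) ↥(hankelKer (momentFunctional α) a k ⊓ hankelKer (momentFunctional β) b k) +
      (Matrix.fromRows (hankel a k α) (hankel b k β)).rank = k := by
  refine finrank_add_rank_of_mulVec_eq_zero_iff
    (inf_le_left.trans (hankelKer_le_degreeLT _ _ _)) fun v => ?_
  have key : ∀ {a : ℕ} (α : Fin (a + k - 1) → ZMod 2), hankel a k α *ᵥ v = 0 ↔
      ((degreeLTEquiv (ZMod 2) k).symm v : (ZMod 2)[X]) ∈ hankelKer (momentFunctional α) a k := by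
    intro a α
    rw [mem_hankelKer_iff_X_pow, and_iff_right ((degreeLTEquiv (ZMod 2) k).symm v).2,
      funext_iff]
    refine forall_congr' fun i => ?_
    rw [map_X_pow_mul_degreeLTEquiv_symm]
    have : ∀ j : Fin k, momentFunctional α (X ^ ((i : ℕ) + (j : ℕ))) = hankel a k α i j :=
      fun j => momentFunctional_X_pow α ⟨(i : ℕ) + (j : ℕ), by omega⟩
    simp only [this]
    rfl
  rw [Matrix.fromRows_mulVec, Submodule.mem_inf, ← key α, ← key β]
  constructor
  · intro h
    exact ⟨funext fun i => congrFun h (Sum.inl i), funext fun i => congrFun h (Sum.inr i)⟩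
  · rintro ⟨h1, h2⟩
    rw [h1, h2]
    ext (i | i) <;> rfl

end HankelRank

section Count

/-- Double counting of the incidences between vectors of length `c` and a finite family of
subspaces of polynomials over `ZMod 2`, when every nonzero vector lies in `b` of them. -/
theorem sum_two_pow_finrank {ι : Type*} [Fintype ι] {c b : ℕ}
    (Q : ι → Submodule (ZMod 2) (ZMod 2)[X]) (hQ : ∀ i, Q i ≤ degreeLT (ZMod 2) c)
    (hb : ∀ v ∈ degreeLT (ZMod 2) c, v ≠ 0 → Nat.card {i // v ∈ Q i} = b) :
    ∑ i, 2 ^ finrank (ZMod 2) (Q i) + b = Fintype.card ι + 2 ^ c * b := by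
  classical
  have hcard : ∀ i, 2 ^ finrank (ZMod 2) (Q i) = ∑ v : Fin c → ZMod 2,
      if ((degreeLTEquiv (ZMod 2) c).symm v : (ZMod 2)[X]) ∈ Q i then 1 else 0 := by
    intro i
    have : FiniteDimensional (ZMod 2) (Q i) := Submodule.finiteDimensional_of_le (hQ i)
    have h1 := Module.natCard_eq_pow_finrank (K := ZMod 2) (V := Q i)
    rw [Nat.card_zmod] at h1
    rw [← h1, ← Finset.card_filter, ← Fintype.card_subtype, ← Nat.card_eq_fintype_card]
    refine Nat.card_congr
      { toFun := fun p => ⟨degreeLTEquiv (ZMod 2) c ⟨p, hQ i p.2⟩, by simp⟩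
        invFun := fun v => ⟨_, v.2⟩
        left_inv := fun p => by simp
        right_inv := fun v => by simp }
  have hsum : ∑ i, 2 ^ finrank (ZMod 2) (Q i) = ∑ v : Fin c → ZMod 2,
      if v = 0 then Fintype.card ι else b := by
    simp only [hcard]
    rw [Finset.sum_comm]
    refine Finset.sum_congr rfl fun v _ => ?_
    split_ifs with hv
    · subst hv
      simp
    · rw [← hb _ ((degreeLTEquiv (ZMod 2) c).symm v).2 (by simpa using hv),
        ← Finset.card_filter, ← Fintype.card_subtype, Nat.card_eq_fintype_card]
  have hone : ∀ v : Fin c → ZMod 2, (if v = 0 then Fintype.card ι else b) +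
      (if v = 0 then b else 0) = b + if v = 0 then Fintype.card ι else 0 := by
    intro v
    split_ifs <;> omega
  have := Finset.sum_congr (rfl : (Finset.univ : Finset (Fin c → ZMod 2)) = _) fun v _ => hone v
  simp only [Finset.sum_add_distrib, Finset.sum_ite_eq', Finset.mem_univ, if_true,
    Finset.sum_const, Finset.card_univ, Fintype.card_fun, ZMod.card, Fintype.card_fin,
    smul_eq_mul] at this
  rw [hsum]
  omega

theorem card_mem_hankelKer {n r c : ℕ} (hn : n + 1 = r + c) {v : (ZMod 2)[X]} (hv : v ≠ 0)
    (hvc : v ∈ degreeLT (ZMod 2) c) :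
    Nat.card {α : Fin n → ZMod 2 // v ∈ hankelKer (momentFunctional α) r c} = 2 ^ (c - 1) := by
  obtain ⟨S, hS, hmem⟩ := finrank_ker_moment hn hv hvc
  have h1 := Module.natCard_eq_pow_finrank (K := ZMod 2) (V := S)
  rw [Nat.card_zmod, hS] at h1
  rw [← h1]
  exact Nat.card_congr (Equiv.subtypeEquivRight fun α => (hmem α).symm)

theorem sum_two_pow_finrank_hankelKer {n r c : ℕ} (hn : n + 1 = r + c) :
    ∑ α : Fin n → ZMod 2, 2 ^ finrank (ZMod 2) (hankelKer (momentFunctional α) r c) +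
      2 ^ (c - 1) = 2 ^ n + 2 ^ c * 2 ^ (c - 1) := by
  rw [sum_two_pow_finrank (fun α : Fin n → ZMod 2 => hankelKer (momentFunctional α) r c)
    (fun α => hankelKer_le_degreeLT _ _ _) fun v hvc hv => card_mem_hankelKer hn hv hvc]
  simp

theorem sum_two_pow_finrank_inf_hankelKer {n₁ n₂ r₁ r₂ c : ℕ} (h₁ : n₁ + 1 = r₁ + c)
    (h₂ : n₂ + 1 = r₂ + c) :
    ∑ p : (Fin n₁ → ZMod 2) × (Fin n₂ → ZMod 2),
        2 ^ finrank (ZMod 2) ↥(hankelKer (momentFunctional p.1) r₁ c ⊓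
          hankelKer (momentFunctional p.2) r₂ c) +
      2 ^ (c - 1) * 2 ^ (c - 1) = 2 ^ n₁ * 2 ^ n₂ + 2 ^ c * (2 ^ (c - 1) * 2 ^ (c - 1)) := by
  rw [sum_two_pow_finrank (fun p : (Fin n₁ → ZMod 2) × (Fin n₂ → ZMod 2) =>
    hankelKer (momentFunctional p.1) r₁ c ⊓ hankelKer (momentFunctional p.2) r₂ c)
    (fun p => inf_le_left.trans (hankelKer_le_degreeLT _ _ _)) (b := 2 ^ (c - 1) * 2 ^ (c - 1))
    fun v hvc hv => ?_]
  · simp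
  · refine Eq.trans ?_ (congrArg₂ (· * ·) (card_mem_hankelKer h₁ hv hvc)
      (card_mem_hankelKer h₂ hv hvc))
    rw [← Nat.card_prod]
    exact Nat.card_congr (Equiv.subtypeProdEquivProd
      (p := fun α : Fin n₁ → ZMod 2 => v ∈ hankelKer (momentFunctional α) r₁ c)
      (q := fun α : Fin n₂ → ZMod 2 => v ∈ hankelKer (momentFunctional α) r₂ c))

/-- The pairs `(α, β)` of rank `s` are those whose pair kernel is generated in degree `s`, together
with those for which `β = 0` and `α` has no relation of length `s + 1`. -/
theorem rank_fromRows_hankel_eq_iff_s7 {s m k : ℕ} (hm : 1 ≤ m) (hk : s < k)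
    (α : Fin (s + k - 1) → ZMod 2) (β : Fin (s + m + k - 1) → ZMod 2) :
    (Matrix.fromRows (hankel s k α) (hankel (s + m) k β)).rank = s ↔
      finrank (ZMod 2) ↥(hankelKer (momentFunctional α) (s + k - (s + 1)) (s + 1) ⊓
        hankelKer (momentFunctional β) (s + m + k - (s + 1)) (s + 1)) = 1 ∨
      β = 0 ∧ finrank (ZMod 2)
        (hankelKer (momentFunctional α) (s + k - (s + 1)) (s + 1)) = 0 := by
  have hrank := finrank_add_rank_fromRows_hankel α β
  rcases hankelKer_dichotomy (momentFunctional α) (momentFunctional β) (M := s + k)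
    (M₁ := s + k) (M₂ := s + m + k) (c₀ := s + 1) le_rfl (by omega) (by omega) (by omega) with
    h | ⟨e, he1, hes, hfin⟩
  · have hbot := h (s + 1) le_rfl
    rw [hbot, finrank_bot]
    rw [show s + k - (s + 1) = k - 1 by omega, show s + m + k - (s + 1) = k + m - 1 by omega]
      at hbot
    rw [show s + k - (s + 1) = k - 1 by omega]
    constructor
    · intro hr
      have hβ : β = 0 := eq_zero_of_momentFunctional
        (map_eq_zero_of_finrank_hankelKer hm hk (by omega) hbot)
      rw [hβ, momentFunctional_zero, hankelKer_zero,
        inf_eq_left.2 (hankelKer_le_degreeLT _ _ _)] at hbot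
      exact Or.inr ⟨hβ, by rw [hbot, finrank_bot]⟩
    · rintro (h0 | ⟨rfl, h0⟩)
      · omega
      · rw [momentFunctional_zero, hankelKer_zero,
          inf_eq_left.2 (hankelKer_le_degreeLT _ _ _)] at hbot hrank
        have := finrank_hankelKer_of_eq_bot hk hbot
        omega
  · have h1 := hfin (s + 1) (by omega)
    have h2 := hfin k (by omega)
    rw [show s + k - k = s by omega, show s + m + k - k = s + m by omega] at h2
    rw [h1]
    have h3 : ¬ (β = 0 ∧ finrank (ZMod 2)
        (hankelKer (momentFunctional α) (s + k - (s + 1)) (s + 1)) = 0) := by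
      rintro ⟨rfl, h0⟩
      rw [momentFunctional_zero, hankelKer_zero,
        inf_eq_left.2 (hankelKer_le_degreeLT _ _ _)] at h1
      omega
    rw [or_iff_left h3]
    omega

theorem indicator_finrank_inf_eq_one {K : Type*} [Field K] {s k m : ℕ} (hs : 1 ≤ s) (hk : s < k)
    (L₁ L₂ : K[X] →ₗ[K] K) {f : ℕ → ℕ}
    (hf : ∀ c, f c = finrank K
      ↥(hankelKer L₁ (s + k - c) c ⊓ hankelKer L₂ (s + m + k - c) c)) :
    ((if f (s + 1) = 1 then 1 else 0 : ℕ) : ℤ) =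
        2 ^ f (s + 1) - 3 * 2 ^ f s + 2 * 2 ^ f (s - 1) ∧
      ((if f (s + 1) = 0 then 1 else 0 : ℕ) : ℤ) = 2 * 2 ^ f s - 2 ^ f (s + 1) := by
  rcases hankelKer_dichotomy L₁ L₂ (M := s + k) (M₁ := s + k) (M₂ := s + m + k) (c₀ := s + 1)
    le_rfl (by omega) (by omega) (by omega) with h | ⟨e, he1, hes, hfin⟩
  · have h0 : ∀ c ≤ s + 1, f c = 0 := fun c hc => by rw [hf, h c hc, finrank_bot]
    rw [h0 _ le_rfl, h0 s (by omega), h0 (s - 1) (by omega)]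
    simp
  · have h1 : ∀ c ≤ s + 1, f c = c + 1 - e := fun c hc => by rw [hf, hfin c (by omega)]
    rw [h1 _ le_rfl, h1 s (by omega), h1 (s - 1) (by omega)]
    obtain ⟨t, ht⟩ : ∃ t, s + 1 = e + t := ⟨s + 1 - e, by omega⟩
    rw [show s + 1 + 1 - e = t + 1 by omega, show s + 1 - e = t by omega,
      show s - 1 + 1 - e = t - 1 by omega]
    rcases t with _ | t
    · simp
    · rw [if_neg (by omega), if_neg (by omega), Nat.add_sub_cancel]
      constructor <;> push_cast <;> ring

end Count

theorem Gamma_s_of_general_case (s m k : ℕ) (hs : 2 ≤ s) (hm : 1 ≤ m) (hk : s < k) :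
    (Gamma s (s + m) k s : ℤ) = 2 ^ (k + s - 1) + 21 * 2 ^ (3 * s - 4) - 11 * 2 ^ (2 * s - 3) := by
  classical
  let f : (Fin (s + k - 1) → ZMod 2) → (Fin (s + m + k - 1) → ZMod 2) → ℕ → ℕ := fun α β c =>
    finrank (ZMod 2) ↥(hankelKer (momentFunctional α) (s + k - c) c ⊓
      hankelKer (momentFunctional β) (s + m + k - c) c)
  have hind := fun α β => indicator_finrank_inf_eq_one (m := m) (by omega) hk
    (momentFunctional α) (momentFunctional β) (f := f α β) fun _ => rfl
  have hf0 : ∀ α c, f α 0 c = finrank (ZMod 2) (hankelKer (momentFunctional α) (s + k - c) c) := by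
    intro α c
    change finrank (ZMod 2) ↥(_ ⊓ hankelKer (momentFunctional 0) _ _) = _
    rw [momentFunctional_zero, hankelKer_zero, inf_eq_left.2 (hankelKer_le_degreeLT _ _ _)]
  have hpair : ∀ c, 1 ≤ c → c ≤ s + 1 → (∑ p : (Fin (s + k - 1) → ZMod 2) ×
      (Fin (s + m + k - 1) → ZMod 2), (2 : ℤ) ^ f p.1 p.2 c) = 2 ^ (s + k - 1) *
        2 ^ (s + m + k - 1) + (2 ^ c - 1) * (2 ^ (c - 1) * 2 ^ (c - 1)) := by
    intro c hc hcs
    have := sum_two_pow_finrank_inf_hankelKer (n₁ := s + k - 1) (n₂ := s + m + k - 1)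
      (r₁ := s + k - c) (r₂ := s + m + k - c) (c := c) (by omega) (by omega)
    zify at this
    linear_combination this
  have hsingle : ∀ c, 1 ≤ c → c ≤ s + 1 → (∑ α : Fin (s + k - 1) → ZMod 2, (2 : ℤ) ^ f α 0 c) =
      2 ^ (s + k - 1) + (2 ^ c - 1) * 2 ^ (c - 1) := by
    intro c hc hcs
    have := sum_two_pow_finrank_hankelKer (n := s + k - 1) (r := s + k - c) (c := c) (by omega)
    zify at this
    simp only [hf0]
    linear_combination this
  have hGamma : Gamma s (s + m) k s = ∑ p : (Fin (s + k - 1) → ZMod 2) ×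
      (Fin (s + m + k - 1) → ZMod 2), (if f p.1 p.2 (s + 1) = 1 then 1 else 0) +
      ∑ α : Fin (s + k - 1) → ZMod 2, if f α 0 (s + 1) = 0 then 1 else 0 := by
    have hsplit : ∑ α : Fin (s + k - 1) → ZMod 2, (if f α 0 (s + 1) = 0 then 1 else 0) =
        ∑ p : (Fin (s + k - 1) → ZMod 2) × (Fin (s + m + k - 1) → ZMod 2),
          if p.2 = 0 ∧ f p.1 0 (s + 1) = 0 then 1 else 0 := by
      rw [Fintype.sum_prod_type]
      simp [ite_and]
    rw [hsplit, ← Finset.sum_add_distrib, Gamma, Nat.card_eq_fintype_card, Fintype.card_subtype,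
      Finset.card_filter]
    refine Finset.sum_congr rfl fun ⟨α, β⟩ _ => ?_
    have hiff := rank_fromRows_hankel_eq_iff_s7 hm hk α β
    rw [← hf0] at hiff
    change _ ↔ f α β (s + 1) = 1 ∨ _ at hiff
    dsimp only
    by_cases h1 : f α β (s + 1) = 1
    · have h2 : ¬ (β = 0 ∧ f α 0 (s + 1) = 0) := by
        rintro ⟨rfl, h⟩
        omega
      rw [if_pos (hiff.2 (Or.inl h1)), if_pos h1, if_neg h2]
    · rw [or_iff_right h1] at hiff
      simp only [hiff, h1, if_false, zero_add]
  rw [hGamma, Nat.cast_add, Nat.cast_sum, Nat.cast_sum,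
    Finset.sum_congr rfl fun p _ => (hind p.1 p.2).1,
    Finset.sum_congr rfl fun α _ => (hind α 0).2]
  simp only [Finset.sum_add_distrib, Finset.sum_sub_distrib, ← Finset.mul_sum]
  rw [hpair _ (by omega) le_rfl, hpair s (by omega) (by omega), hpair (s - 1) (by omega) (by omega),
    hsingle _ (by omega) le_rfl, hsingle s (by omega) (by omega)]
  obtain ⟨t, rfl⟩ := Nat.exists_eq_add_of_le hs
  rw [show 2 + t + 1 - 1 = t + 2 by omega, show 2 + t - 1 - 1 = t by omega,
    show 2 + t - 1 = t + 1 by omega, show 3 * (2 + t) - 4 = 3 * t + 2 by omega,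
    show 2 * (2 + t) - 3 = 2 * t + 1 by omega, show k + (2 + t) - 1 = 2 + t + k - 1 by omega]
  ring
end
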